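/- arXiv:0903.1359 — 6 statements merged into one kernel-verified Lean document; each statement's English description precedes it below -/
import Mathlib

section
/- Let n and k be positive integers with k+1 coprime to n. For every y ∈ ℤ_n, the number of (k+1)-element subsets σ of ℤ_n with ∑_{x∈σ} x = y equals (1/n)·C(n, k+1) (equivalently, n divides C(n,k+1) and the count is C(n,k+1)/n). -/
open scoped BigOperators

/-- Translating an `m`-element set by `t` adds `m • t` to its element-sum. -/
theorem card_filter_card_eq_sum_eq_add_nsmul {G : Type*} [AddCommGroup G] [Fintype G]
    [DecidableEq G] (m : ℕ) (y t : G) :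
    (Finset.univ.filter (fun σ : Finset G => σ.card = m ∧ ∑ x ∈ σ, x = y + m • t)).card =
      (Finset.univ.filter (fun σ : Finset G => σ.card = m ∧ ∑ x ∈ σ, x = y)).card := by
  symm
  refine Finset.card_equiv (Equiv.addRight t).finsetCongr fun σ => ?_
  simp only [Finset.mem_filter, Finset.mem_univ, true_and, Equiv.finsetCongr_apply,
    Finset.card_map, Finset.sum_map, Equiv.coe_toEmbedding, Equiv.coe_addRight,
    Finset.sum_add_distrib, Finset.sum_const]
  refine and_congr_right fun hσ => ?_
  rw [hσ, add_left_inj]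

/-- If `m` is coprime to the order of a finite abelian group, then the `m`-element subsets are
equidistributed among the possible element-sums. -/
theorem card_mul_card_filter_card_eq_sum_eq {G : Type*} [AddCommGroup G] [Fintype G]
    [DecidableEq G] {m : ℕ} (hm : m.Coprime (Fintype.card G)) (y : G) :
    Fintype.card G *
        (Finset.univ.filter (fun σ : Finset G => σ.card = m ∧ ∑ x ∈ σ, x = y)).card =
      (Fintype.card G).choose m := by
  have hconst (z : G) :
      (Finset.univ.filter (fun σ : Finset G => σ.card = m ∧ ∑ x ∈ σ, x = z)).card =
        (Finset.univ.filter (fun σ : Finset G => σ.card = m ∧ ∑ x ∈ σ, x = y)).card := by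
    have hG : (Nat.card G).Coprime m := by rw [Nat.card_eq_fintype_card]; exact hm.symm
    obtain ⟨t, ht⟩ := (nsmulCoprime hG).surjective (z - y)
    rw [← card_filter_card_eq_sum_eq_add_nsmul m y t]
    rw [nsmulCoprime_apply] at ht
    rw [ht, add_sub_cancel]
  have hfib := Finset.card_eq_sum_card_fiberwise (s := Finset.univ.powersetCard m)
    (t := (Finset.univ : Finset G)) (f := fun σ => ∑ x ∈ σ, x) fun _ _ => Finset.mem_univ _
  rw [Finset.card_powersetCard, Finset.card_univ] at hfib
  rw [hfib, ← Finset.card_univ, ← smul_eq_mul, ← Finset.sum_const]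
  refine Finset.sum_congr rfl fun z _ => ?_
  rw [← hconst z]
  congr 1
  ext σ
  simp [Finset.mem_powersetCard]

/-- For `n, k` positive with `k+1` coprime to `n`, for every `y ∈ ℤ_n` the number
of `(k+1)`-element subsets of `ℤ_n` with element-sum `y` equals `C(n, k+1)/n`
(and `n` divides `C(n, k+1)`). -/
theorem sum_complex_facet_count_per_class (n k : ℕ) [NeZero n] (hk : 0 < k)
    (hcop : Nat.Coprime (k + 1) n) :
    n ∣ Nat.choose n (k + 1) ∧
    ∀ y : ZMod n,
      (Finset.univ.filter
          (fun σ : Finset (ZMod n) => σ.card = k + 1 ∧ (∑ x ∈ σ, x) = y)).card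
        = Nat.choose n (k + 1) / n := by
  have hcount (y : ZMod n) := card_mul_card_filter_card_eq_sum_eq
    (m := k + 1) (by rwa [ZMod.card]) y
  simp only [ZMod.card] at hcount
  exact ⟨⟨_, (hcount 0).symm⟩, fun y =>
    (Nat.div_eq_of_eq_mul_right (NeZero.pos n) (hcount y).symm).symm⟩
end

section
/- Let n, k be positive integers with k+1 coprime to n, let A ⊆ ℤ_n with |A| = k+1, and let F be a field whose characteristic does not divide n and which contains a primitive n-th root of unity ω. Then h_k(X_A;F), the dimension of the kernel of the boundary map ∂ restricted to the F-span of the facets of X_A, equals (1/(k+1)) · ∑_{B ∈ B_{n,k}} dim_F ker M_{A,B}, where the sum is over all (k+1)-element subsets B of ℤ_n containing 0. -/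
open scoped BigOperators

/-- The facets of the sum complex `X_A`. -/
def sumComplexFacets (n k : ℕ) [NeZero n] (A : Finset (ZMod n)) :
    Finset (Finset (ZMod n)) :=
  Finset.univ.filter (fun σ => σ.card = k + 1 ∧ (∑ x ∈ σ, x) ∈ A)

/-- Coefficient of `τ` in the simplicial boundary of `σ`, ordering the elements of `σ`
by their representatives in `{0, …, n-1}`: it is `(-1)^i` if `τ = σ \ {x}` where `x`
is the `i`-th smallest element of `σ`, and `0` otherwise. -/
noncomputable def bdryCoeff (n : ℕ) [NeZero n] (F : Type*) [Field F]
    (σ τ : Finset (ZMod n)) : F :=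
  ∑ x ∈ σ, if τ = σ.erase x then
    (-1 : F) ^ ((σ.filter (fun y => y.val < x.val)).card) else 0

/-- The simplicial boundary operator `∂` on the chain space of `ℤ_n`
(the free `F`-vector space on the finite subsets of `ℤ_n`). -/
noncomputable def bdry (n : ℕ) [NeZero n] (F : Type*) [Field F] :
    (Finset (ZMod n) → F) →ₗ[F] (Finset (ZMod n) → F) where
  toFun c := fun τ => ∑ σ : Finset (ZMod n), c σ * bdryCoeff n F σ τ
  map_add' c d := by
    funext τ
    simp [add_mul, Finset.sum_add_distrib]
  map_smul' r c := by
    funext τ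
    simp [Finset.mul_sum, mul_assoc]

/-- The basis vector of the chain space corresponding to a finite subset `σ ⊆ ℤ_n`. -/
noncomputable def ind (n : ℕ) [NeZero n] (F : Type*) [Field F] (σ : Finset (ZMod n)) :
    Finset (ZMod n) → F :=
  fun τ => if τ = σ then 1 else 0

/-- `h_k(X_A; F)`: the dimension of the kernel of the restriction of the boundary
operator `∂` to the span of the facets of the sum complex `X_A`. -/
noncomputable def hTop (n : ℕ) [NeZero n] (F : Type*) [Field F] (k : ℕ)
    (A : Finset (ZMod n)) : ℕ :=
  Module.finrank F (LinearMap.ker ((bdry n F).domRestrict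
    (Submodule.span F (ind n F '' ↑(sumComplexFacets n k A)))))

/-- The submatrix of the Fourier matrix `M(u,v) = ω^{-uv}` with rows indexed by `A`
and columns indexed by `B`. -/
noncomputable def fourierSubmatrix (n : ℕ) [NeZero n] (F : Type*) [Field F] (ω : F)
    (A B : Finset (ZMod n)) : Matrix {a // a ∈ A} {b // b ∈ B} F :=
  fun a b => ω ^ (-(a.1 * b.1)).val

namespace SumComplex

open Finset

section Enumeration

variable {n : ℕ} [NeZero n] {m : ℕ}

lemma card_image_val (σ : Finset (ZMod n)) : (σ.image ZMod.val).card = σ.card :=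
  card_image_of_injective σ (ZMod.val_injective n)

/-- The increasing enumeration (by representatives) of an `m`-element subset of `ℤ_n`. -/
noncomputable def enum (σ : {σ : Finset (ZMod n) // σ.card = m}) (i : Fin m) : ZMod n :=
  (((σ.1.image ZMod.val).orderEmbOfFin ((card_image_val σ.1).trans σ.2) i : ℕ) : ZMod n)

lemma val_enum (σ : {σ : Finset (ZMod n) // σ.card = m}) (i : Fin m) :
    (enum σ i).val =
      (σ.1.image ZMod.val).orderEmbOfFin ((card_image_val σ.1).trans σ.2) i := by
  have h := (σ.1.image ZMod.val).orderEmbOfFin_mem ((card_image_val σ.1).trans σ.2) i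
  obtain ⟨x, -, hx⟩ := mem_image.1 h
  rw [enum, ← hx, ZMod.natCast_zmod_val]

lemma enum_mem (σ : {σ : Finset (ZMod n) // σ.card = m}) (i : Fin m) : enum σ i ∈ σ.1 := by
  have h := (σ.1.image ZMod.val).orderEmbOfFin_mem ((card_image_val σ.1).trans σ.2) i
  obtain ⟨x, hxσ, hx⟩ := mem_image.1 h
  rwa [enum, ← hx, ZMod.natCast_zmod_val]

lemma enum_val_strictMono (σ : {σ : Finset (ZMod n) // σ.card = m}) :
    StrictMono fun i => (enum σ i).val := by
  intro i j hij
  simpa only [val_enum] using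
    ((σ.1.image ZMod.val).orderEmbOfFin ((card_image_val σ.1).trans σ.2)).strictMono hij

lemma enum_injective (σ : {σ : Finset (ZMod n) // σ.card = m}) :
    Function.Injective (enum σ) := fun _ _ h =>
  (enum_val_strictMono σ).injective (congrArg ZMod.val h)

lemma image_enum (σ : {σ : Finset (ZMod n) // σ.card = m}) : univ.image (enum σ) = σ.1 := by
  apply eq_of_subset_of_card_le
  · intro x hx
    obtain ⟨i, -, rfl⟩ := mem_image.1 hx
    exact enum_mem σ i
  · rw [card_image_of_injective _ (enum_injective σ), σ.2, card_univ, Fintype.card_fin]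

lemma exists_enum_eq (σ : {σ : Finset (ZMod n) // σ.card = m}) {x : ZMod n} (hx : x ∈ σ.1) :
    ∃ i, enum σ i = x := by
  rw [← image_enum σ] at hx
  simpa using hx

lemma sum_enum {M : Type*} [AddCommMonoid M] (σ : {σ : Finset (ZMod n) // σ.card = m})
    (g : ZMod n → M) : ∑ i, g (enum σ i) = ∑ x ∈ σ.1, g x := by
  conv_rhs => rw [← image_enum σ]
  rw [sum_image fun _ _ _ _ h => enum_injective σ h]

lemma eq_enum (σ : {σ : Finset (ZMod n) // σ.card = m}) {e : Fin m → ZMod n}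
    (he : ∀ i, e i ∈ σ.1) (hmono : StrictMono fun i => (e i).val) : e = enum σ := by
  have h := Finset.orderEmbOfFin_unique ((card_image_val σ.1).trans σ.2)
    (fun i => mem_image_of_mem ZMod.val (he i)) hmono
  funext i
  apply ZMod.val_injective n
  rw [val_enum]
  exact congrFun h i

lemma card_filter_val_lt_enum (σ : {σ : Finset (ZMod n) // σ.card = m}) (j : Fin m) :
    (σ.1.filter fun y => y.val < (enum σ j).val).card = j := by
  conv_lhs => rw [← image_enum σ]
  rw [filter_image, card_image_of_injective _ (enum_injective σ)]
  simp only [(enum_val_strictMono σ).lt_iff_lt]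
  rw [filter_gt_eq_Iio, Fin.card_Iio]

omit [NeZero n] in
lemma exists_perm_of_injective {x y : Fin m → ZMod n} (hx : Function.Injective x)
    (h : ∀ i, ∃ j, y j = x i) : ∃ π : Equiv.Perm (Fin m), x = y ∘ π := by
  choose p hp using h
  have hpi : Function.Injective p := fun i j hij => hx (by rw [← hp, ← hp, hij])
  exact ⟨Equiv.ofBijective p (Finite.injective_iff_bijective.1 hpi),
    funext fun i => (hp i).symm⟩

lemma exists_perm_enum {x : Fin m → ZMod n} (hx : Function.Injective x) :
    ∃ (σ : {σ : Finset (ZMod n) // σ.card = m}) (π : Equiv.Perm (Fin m)), x = enum σ ∘ π := by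
  let σ : {σ : Finset (ZMod n) // σ.card = m} :=
    ⟨univ.image x, by rw [card_image_of_injective _ hx, card_univ, Fintype.card_fin]⟩
  exact ⟨σ, exists_perm_of_injective hx fun i =>
    exists_enum_eq σ (mem_image_of_mem x (mem_univ i))⟩

end Enumeration

section Alternating

variable {n : ℕ} [NeZero n] {F : Type*} [Field F] {m : ℕ}

/-- The alternating `F`-valued functions of `m` variables in `ℤ_n`. -/
def alternating (n : ℕ) (F : Type*) [Field F] (m : ℕ) : Submodule F ((Fin m → ZMod n) → F) where
  carrier := {f | (∀ x, ¬ Function.Injective x → f x = 0) ∧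
    ∀ (π : Equiv.Perm (Fin m)) x, f (x ∘ π) = ((Equiv.Perm.sign π : ℤ) : F) * f x}
  add_mem' := by
    rintro f g ⟨hf, hf'⟩ ⟨hg, hg'⟩
    refine ⟨fun x hx => by simp [hf x hx, hg x hx], fun π x => ?_⟩
    simp only [Pi.add_apply, hf', hg', mul_add]
  zero_mem' := by simp
  smul_mem' := by
    rintro r f ⟨hf, hf'⟩
    refine ⟨fun x hx => by simp [hf x hx], fun π x => ?_⟩
    simp only [Pi.smul_apply, hf', smul_eq_mul]
    ring

lemma alternating_eq_zero {f : (Fin m → ZMod n) → F} (hf : f ∈ alternating n F m)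
    (h : ∀ σ, f (enum σ) = 0) : f = 0 := by
  funext x
  by_cases hx : Function.Injective x
  · obtain ⟨σ, π, rfl⟩ := exists_perm_enum hx
    rw [hf.2, h, mul_zero, Pi.zero_apply]
  · exact hf.1 x hx

omit [NeZero n] in
lemma alternating_apply_eq_zero {f : (Fin (m + 1) → ZMod n) → F}
    (hf : f ∈ alternating n F (m + 1)) (h : ∀ z, f (Fin.cons 0 z) = 0)
    {y : Fin (m + 1) → ZMod n} {i : Fin (m + 1)} (hi : y i = 0) : f y = 0 := by
  have h1 : y ∘ Equiv.swap 0 i = Fin.cons 0 (Fin.tail (y ∘ Equiv.swap 0 i)) := by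
    conv_lhs => rw [← Fin.cons_self_tail (y ∘ Equiv.swap 0 i)]
    simp [hi]
  have h2 := hf.2 (Equiv.swap 0 i) y
  rw [h1, h] at h2
  rcases mul_eq_zero.1 h2.symm with h3 | h3
  · rcases Int.units_eq_one_or (Equiv.Perm.sign (Equiv.swap 0 i)) with h4 | h4 <;>
      simp [h4] at h3
  · exact h3

/-- The alternating function dual to the oriented simplex `σ`. -/
noncomputable def simplexDet (F : Type*) [Field F] (σ : {σ : Finset (ZMod n) // σ.card = m})
    (x : Fin m → ZMod n) : F :=
  Matrix.det (Matrix.of fun i j => if x i = enum σ j then (1 : F) else 0)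

lemma simplexDet_mem_alternating (σ : {σ : Finset (ZMod n) // σ.card = m}) :
    simplexDet F σ ∈ alternating n F m := by
  refine ⟨fun x hx => ?_, fun π x => ?_⟩
  · simp only [Function.Injective, not_forall] at hx
    obtain ⟨i, j, hij, hne⟩ := hx
    exact Matrix.det_zero_of_row_eq hne (by funext l; simp [hij])
  · exact Matrix.det_permute π (Matrix.of fun i j => if x i = enum σ j then (1 : F) else 0)

lemma exists_perm_of_simplexDet_ne_zero {σ : {σ : Finset (ZMod n) // σ.card = m}}
    {x : Fin m → ZMod n} (h : simplexDet F σ x ≠ 0) :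
    ∃ π : Equiv.Perm (Fin m), x = enum σ ∘ π := by
  have hx : Function.Injective x := by
    by_contra hx
    exact h ((simplexDet_mem_alternating σ).1 x hx)
  refine exists_perm_of_injective hx fun i => ?_
  by_contra! hi
  exact h (Matrix.det_eq_zero_of_row_eq_zero i fun j => by simp [(hi j).symm])

lemma simplexDet_enum (σ τ : {σ : Finset (ZMod n) // σ.card = m}) :
    simplexDet F σ (enum τ) = if τ = σ then 1 else 0 := by
  split_ifs with h
  · subst h
    simp only [simplexDet, (enum_injective τ).eq_iff]
    exact Matrix.det_one
  · by_contra h0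
    obtain ⟨π, hπ⟩ := exists_perm_of_simplexDet_ne_zero h0
    apply h
    apply Subtype.ext
    apply eq_of_subset_of_card_le _ (by rw [σ.2, τ.2])
    intro x hx
    obtain ⟨i, rfl⟩ := exists_enum_eq τ hx
    rw [hπ]
    exact enum_mem σ _

/-- The alternating function attached to a chain. -/
noncomputable def chainToAlt (n : ℕ) [NeZero n] (F : Type*) [Field F] (m : ℕ) :
    (Finset (ZMod n) → F) →ₗ[F] ((Fin m → ZMod n) → F) where
  toFun c := fun x => ∑ σ : {σ : Finset (ZMod n) // σ.card = m}, c σ.1 * simplexDet F σ x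
  map_add' c d := by
    funext x
    simp [add_mul, Finset.sum_add_distrib]
  map_smul' r c := by
    funext x
    simp [Finset.mul_sum, mul_assoc]

lemma chainToAlt_apply (c : Finset (ZMod n) → F) (x : Fin m → ZMod n) :
    chainToAlt n F m c x =
      ∑ σ : {σ : Finset (ZMod n) // σ.card = m}, c σ.1 * simplexDet F σ x := rfl

/-- The chain given by the values of a function at the oriented simplices. -/
noncomputable def altToChain (n : ℕ) [NeZero n] (F : Type*) [Field F] (m : ℕ) :
    ((Fin m → ZMod n) → F) →ₗ[F] (Finset (ZMod n) → F) where
  toFun f := fun σ => if h : σ.card = m then f (enum ⟨σ, h⟩) else 0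
  map_add' f g := by
    funext σ
    by_cases h : σ.card = m <;> simp [h]
  map_smul' r f := by
    funext σ
    by_cases h : σ.card = m <;> simp [h]

lemma altToChain_apply (f : (Fin m → ZMod n) → F) (σ : {σ : Finset (ZMod n) // σ.card = m}) :
    altToChain n F m f σ.1 = f (enum σ) := dif_pos σ.2

lemma altToChain_apply_of_card_ne (f : (Fin m → ZMod n) → F) {σ : Finset (ZMod n)}
    (hσ : σ.card ≠ m) : altToChain n F m f σ = 0 := dif_neg hσ

lemma chainToAlt_mem_alternating (c : Finset (ZMod n) → F) :
    chainToAlt n F m c ∈ alternating n F m := by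
  have h : chainToAlt n F m c =
      ∑ σ : {σ : Finset (ZMod n) // σ.card = m}, c σ.1 • simplexDet F σ := by
    funext x
    simp [chainToAlt_apply]
  rw [h]
  exact sum_mem fun σ _ => Submodule.smul_mem _ _ (simplexDet_mem_alternating σ)

lemma chainToAlt_enum (c : Finset (ZMod n) → F) (τ : {σ : Finset (ZMod n) // σ.card = m}) :
    chainToAlt n F m c (enum τ) = c τ.1 := by
  simp [chainToAlt_apply, simplexDet_enum]

lemma chainToAlt_altToChain {f : (Fin m → ZMod n) → F} (hf : f ∈ alternating n F m) :
    chainToAlt n F m (altToChain n F m f) = f := by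
  apply sub_eq_zero.1
  apply alternating_eq_zero (Submodule.sub_mem _ (chainToAlt_mem_alternating _) hf)
  intro σ
  rw [Pi.sub_apply, chainToAlt_enum, altToChain_apply, sub_self]

lemma chainToAlt_eq_zero_of_sum_notMem {A : Finset (ZMod n)} {c : Finset (ZMod n) → F}
    (hc : ∀ σ, ∑ x ∈ σ, x ∉ A → c σ = 0) {x : Fin m → ZMod n} (hx : ∑ i, x i ∉ A) :
    chainToAlt n F m c x = 0 := by
  refine sum_eq_zero fun σ _ => ?_
  by_cases h : simplexDet F σ x = 0
  · rw [h, mul_zero]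
  · obtain ⟨π, rfl⟩ := exists_perm_of_simplexDet_ne_zero h
    rw [hc, zero_mul]
    rwa [← sum_enum σ fun x => x, ← Equiv.sum_comp π]

/-- Summation over the first variable. -/
noncomputable def sumFirst (f : (Fin (m + 1) → ZMod n) → F) (y : Fin m → ZMod n) : F :=
  ∑ v : ZMod n, f (Fin.cons v y)

lemma sumFirst_mem_alternating {f : (Fin (m + 1) → ZMod n) → F}
    (hf : f ∈ alternating n F (m + 1)) : sumFirst f ∈ alternating n F m := by
  refine ⟨fun y hy => sum_eq_zero fun v _ => hf.1 _ fun h => hy ?_, fun π y => ?_⟩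
  · have := h.comp (Fin.succ_injective m)
    exact fun i j hij => this (by simpa using hij)
  · rw [sumFirst, sumFirst, mul_sum]
    refine sum_congr rfl fun v _ => ?_
    have h1 : (Fin.cons v (y ∘ π) : Fin (m + 1) → ZMod n) =
        Fin.cons v y ∘ Equiv.Perm.decomposeFin.symm (0, π) := by
      funext i
      refine Fin.cases ?_ (fun i => ?_) i <;> simp
    rw [h1, hf.2]
    simp

lemma simplexDet_cons_enum (σ : {σ : Finset (ZMod n) // σ.card = m + 1})
    (τ : {σ : Finset (ZMod n) // σ.card = m}) (v : ZMod n) :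
    simplexDet F σ (Fin.cons v (enum τ)) =
      ∑ j, if v = enum σ j then
        (if τ.1 = σ.1.erase (enum σ j) then (-1 : F) ^ (j : ℕ) else 0) else 0 := by
  rw [simplexDet, Matrix.det_succ_row_zero]
  refine sum_congr rfl fun j _ => ?_
  have hcard : (σ.1.erase (enum σ j)).card = m := by
    rw [card_erase_of_mem (enum_mem σ j), σ.2, Nat.add_sub_cancel]
  have hsub : enum σ ∘ j.succAbove = enum ⟨σ.1.erase (enum σ j), hcard⟩ := by
    refine eq_enum _ (fun i => mem_erase.2 ⟨fun h => ?_, enum_mem σ _⟩) ?_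
    · exact Fin.succAbove_ne j i (enum_injective σ h)
    · exact (enum_val_strictMono σ).comp (Fin.strictMono_succAbove j)
  have hdet : ((Matrix.of fun i l => if (Fin.cons v (enum τ) : Fin (m + 1) → ZMod n) i = enum σ l
      then (1 : F) else 0).submatrix Fin.succ j.succAbove).det =
      simplexDet F ⟨σ.1.erase (enum σ j), hcard⟩ (enum τ) := by
    rw [simplexDet, ← hsub]
    rfl
  rw [hdet, simplexDet_enum]
  simp only [Matrix.of_apply, Fin.cons_zero, Subtype.ext_iff]
  split_ifs <;> simp

lemma sumFirst_simplexDet (σ : {σ : Finset (ZMod n) // σ.card = m + 1})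
    (τ : {σ : Finset (ZMod n) // σ.card = m}) :
    sumFirst (simplexDet F σ) (enum τ) = bdryCoeff n F σ.1 τ.1 := by
  simp only [sumFirst, simplexDet_cons_enum]
  rw [sum_comm, bdryCoeff, ← sum_enum σ]
  refine sum_congr rfl fun j _ => ?_
  rw [sum_ite_eq' univ (enum σ j), if_pos (mem_univ _), card_filter_val_lt_enum]

lemma bdry_eq_zero_iff {c : Finset (ZMod n) → F} (hc : ∀ σ, σ.card ≠ m + 1 → c σ = 0) :
    bdry n F c = 0 ↔ sumFirst (chainToAlt n F (m + 1) c) = 0 := by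
  have key : ∀ τ : {σ : Finset (ZMod n) // σ.card = m},
      bdry n F c τ.1 = sumFirst (chainToAlt n F (m + 1) c) (enum τ) := by
    intro τ
    have h1 : sumFirst (chainToAlt n F (m + 1) c) (enum τ) =
        ∑ σ : {σ : Finset (ZMod n) // σ.card = m + 1}, c σ.1 * bdryCoeff n F σ.1 τ.1 := by
      simp only [← sumFirst_simplexDet, sumFirst, chainToAlt_apply, mul_sum]
      rw [sum_comm]
    rw [h1]
    change ∑ σ, c σ * bdryCoeff n F σ τ.1 = _
    rw [← sum_filter_of_ne (p := fun σ : Finset (ZMod n) => σ.card = m + 1)]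
    · exact sum_subtype _ (by simp) fun σ => c σ * bdryCoeff n F σ τ.1
    · intro σ _ h
      by_contra hσ
      exact h (by rw [hc σ hσ, zero_mul])
  constructor
  · intro h
    refine alternating_eq_zero (sumFirst_mem_alternating (chainToAlt_mem_alternating c)) fun τ => ?_
    rw [← key, h, Pi.zero_apply]
  · intro h
    funext τ
    by_cases hτ : τ.card = m
    · exact (key ⟨τ, hτ⟩).trans (by rw [h, Pi.zero_apply, Pi.zero_apply])
    · change ∑ σ, c σ * bdryCoeff n F σ τ = 0
      refine sum_eq_zero fun σ _ => ?_
      by_cases hσ : σ.card = m + 1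
      · rw [bdryCoeff, sum_eq_zero, mul_zero]
        intro x hx
        rw [if_neg]
        rintro rfl
        exact hτ (by rw [card_erase_of_mem hx, hσ, Nat.add_sub_cancel])
      · rw [hc σ hσ, zero_mul]

end Alternating

section Fourier

variable {n : ℕ} [NeZero n] {F : Type*} [Field F] {m : ℕ}

/-- The Fourier transform on functions of `m` variables in `ℤ_n`. -/
noncomputable def fourier (χ : AddChar (ZMod n) F) (m : ℕ) :
    ((Fin m → ZMod n) → F) →ₗ[F] ((Fin m → ZMod n) → F) where
  toFun f := fun y => ∑ x : Fin m → ZMod n, f x * χ (∑ i, x i * y i)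
  map_add' c d := by
    funext τ
    simp [add_mul, Finset.sum_add_distrib]
  map_smul' r c := by
    funext τ
    simp [Finset.mul_sum, mul_assoc]

lemma fourier_apply (χ : AddChar (ZMod n) F) (f : (Fin m → ZMod n) → F) (y : Fin m → ZMod n) :
    fourier χ m f y = ∑ x : Fin m → ZMod n, f x * χ (∑ i, x i * y i) := rfl

lemma sum_char_mul {χ : AddChar (ZMod n) F} (hχ : χ.IsPrimitive) (a : ZMod n) :
    ∑ t, χ (a * t) = if a = 0 then (n : F) else 0 := by
  have h := AddChar.sum_mulShift a hχ
  simp only [ZMod.card, mul_comm _ a] at h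
  rw [h]
  split_ifs <;> simp

omit [NeZero n] in
lemma map_sum_eq_prod {ι : Type*} (χ : AddChar (ZMod n) F) (s : Finset ι) (g : ι → ZMod n) :
    χ (∑ i ∈ s, g i) = ∏ i ∈ s, χ (g i) := by
  classical
  induction s using Finset.induction_on with
  | empty => simp
  | insert i s hi ih => rw [sum_insert hi, prod_insert hi, AddChar.map_add_eq_mul, ih]

omit [NeZero n] in
lemma isPrimitive_inv {χ : AddChar (ZMod n) F} (hχ : χ.IsPrimitive) : χ⁻¹.IsPrimitive := by
  intro a ha h
  refine hχ (neg_ne_zero.2 ha) (DFunLike.ext _ _ fun x => ?_)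
  rw [AddChar.mulShift_apply, neg_mul, ← AddChar.inv_apply, ← AddChar.mulShift_apply, h]

lemma sum_char_dot {χ : AddChar (ZMod n) F} (hχ : χ.IsPrimitive) (x : Fin m → ZMod n) :
    ∑ y : Fin m → ZMod n, χ (∑ i, x i * y i) = if x = 0 then (n : F) ^ m else 0 := by
  simp only [map_sum_eq_prod]
  rw [← Fintype.piFinset_univ, ← Finset.prod_univ_sum (fun _ => univ) fun i t => χ (x i * t)]
  simp only [sum_char_mul hχ]
  split_ifs with h
  · simp [h]
  · obtain ⟨i, hi⟩ := Function.ne_iff.1 h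
    exact prod_eq_zero (mem_univ i) (if_neg hi)

lemma fourier_inv_fourier {χ : AddChar (ZMod n) F} (hχ : χ.IsPrimitive)
    (f : (Fin m → ZMod n) → F) : fourier χ⁻¹ m (fourier χ m f) = (n : F) ^ m • f := by
  funext x
  simp only [fourier_apply, sum_mul]
  rw [sum_comm]
  have h : ∀ z y : Fin m → ZMod n, f z * χ (∑ i, z i * y i) * χ⁻¹ (∑ i, y i * x i) =
      f z * χ (∑ i, (z - x) i * y i) := by
    intro z y
    rw [AddChar.inv_apply, mul_assoc, ← AddChar.map_add_eq_mul, ← sum_neg_distrib,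
      ← sum_add_distrib]
    congr 2
    exact sum_congr rfl fun i _ => by rw [Pi.sub_apply]; ring
  simp only [h, ← mul_sum, sum_char_dot hχ, sub_eq_zero]
  simp [mul_comm]

lemma fourier_eq_zero {χ : AddChar (ZMod n) F} (hχ : χ.IsPrimitive) (hn : (n : F) ≠ 0)
    {f : (Fin m → ZMod n) → F} (h : fourier χ m f = 0) : f = 0 := by
  have h1 := fourier_inv_fourier hχ f
  rw [h, map_zero] at h1
  exact (smul_eq_zero.1 h1.symm).resolve_left (pow_ne_zero _ hn)

lemma fourier_mem_alternating (χ : AddChar (ZMod n) F) {f : (Fin m → ZMod n) → F}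
    (hf : f ∈ alternating n F m) : fourier χ m f ∈ alternating n F m := by
  have reindex : ∀ (π : Equiv.Perm (Fin m)) (x y : Fin m → ZMod n),
      ∑ i, (x ∘ π) i * (y ∘ π) i = ∑ i, x i * y i := fun π x y =>
    Equiv.sum_comp π fun i => x i * y i
  refine ⟨fun y hy => ?_, fun π y => ?_⟩
  · simp only [Function.Injective, not_forall] at hy
    obtain ⟨i, j, hij, hne⟩ := hy
    have hy' : y ∘ Equiv.swap i j = y := by
      funext l
      rw [Function.comp_apply, Equiv.swap_apply_def]
      split_ifs with h1 h2
      · rw [h1, hij]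
      · rw [h2, hij]
      · rfl
    refine sum_involution (fun x _ => x ∘ Equiv.swap i j) (fun x _ => ?_) (fun x _ hx hfix => ?_)
      (fun _ _ => mem_univ _) fun x _ => ?_
    · rw [hf.2, Equiv.Perm.sign_swap hne]
      have h := reindex (Equiv.swap i j) x y
      rw [hy'] at h
      rw [h]
      simp
    · apply hx
      rw [hf.1, zero_mul]
      intro hinj
      apply hne
      apply hinj
      have := congrFun hfix j
      simpa using this
    · funext l
      simp
  · rw [fourier_apply, fourier_apply, mul_sum,
      ← Equiv.sum_comp (Equiv.arrowCongr π.symm (Equiv.refl (ZMod n)))]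
    refine sum_congr rfl fun x _ => ?_
    have h : Equiv.arrowCongr π.symm (Equiv.refl (ZMod n)) x = x ∘ π := rfl
    rw [h, hf.2, reindex, mul_assoc]

lemma fourier_sumFirst (χ : AddChar (ZMod n) F) (f : (Fin (m + 1) → ZMod n) → F)
    (z : Fin m → ZMod n) :
    fourier χ m (sumFirst f) z = fourier χ (m + 1) f (Fin.cons 0 z) := by
  rw [fourier_apply, fourier_apply, ← Equiv.sum_comp (Fin.consEquiv fun _ => ZMod n),
    Fintype.sum_prod_type_right]
  refine sum_congr rfl fun x _ => ?_
  rw [sumFirst, sum_mul]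
  refine sum_congr rfl fun v _ => ?_
  simp [Fin.sum_univ_succ, Fin.consEquiv]

lemma sumFirst_eq_zero_iff {χ : AddChar (ZMod n) F} (hχ : χ.IsPrimitive) (hn : (n : F) ≠ 0)
    (f : (Fin (m + 1) → ZMod n) → F) :
    sumFirst f = 0 ↔ ∀ z, fourier χ (m + 1) f (Fin.cons 0 z) = 0 := by
  simp only [← fourier_sumFirst]
  constructor
  · intro h z
    rw [h, map_zero, Pi.zero_apply]
  · intro h
    exact fourier_eq_zero hχ hn (funext h)

lemma eq_zero_of_sum_char_eq_zero {χ : AddChar (ZMod n) F} (hχ : χ.IsPrimitive)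
    (hn : (n : F) ≠ 0) {g : ZMod n → F} (h : ∀ t, ∑ a, g a * χ (a * t) = 0) (b : ZMod n) :
    g b = 0 := by
  have h1 : ∑ t, (∑ a, g a * χ (a * t)) * χ (-(b * t)) = n * g b := by
    simp only [sum_mul]
    rw [sum_comm]
    have h2 : ∀ a t, g a * χ (a * t) * χ (-(b * t)) = g a * χ ((a - b) * t) := by
      intro a t
      rw [mul_assoc, ← AddChar.map_add_eq_mul]
      congr 2
      ring
    simp only [h2, ← mul_sum, sum_char_mul hχ, sub_eq_zero]
    simp [mul_comm]
  simp only [h, zero_mul, sum_const_zero] at h1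
  exact (mul_eq_zero.1 h1.symm).resolve_left hn

/-- The part of the Fourier transform coming from the points with coordinate sum `a`. -/
noncomputable def fourierSlice (χ : AddChar (ZMod n) F) (m : ℕ) (a : ZMod n)
    (y : Fin m → ZMod n) : ((Fin m → ZMod n) → F) →ₗ[F] F where
  toFun f := ∑ x : Fin m → ZMod n, if ∑ i, x i = a then f x * χ (∑ i, x i * y i) else 0
  map_add' f g := by
    rw [← sum_add_distrib]
    refine sum_congr rfl fun x _ => ?_
    split_ifs <;> simp [add_mul]
  map_smul' r f := by
    rw [smul_eq_mul, mul_sum]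
    refine sum_congr rfl fun x _ => ?_
    split_ifs <;> simp [mul_assoc]

lemma fourier_add_const (χ : AddChar (ZMod n) F) {A : Finset (ZMod n)}
    {f : (Fin m → ZMod n) → F} (hf : ∀ x, ∑ i, x i ∉ A → f x = 0) (y : Fin m → ZMod n)
    (t : ZMod n) :
    fourier χ m f (fun i => y i + t) = ∑ a ∈ A, χ (a * t) * fourierSlice χ m a y f := by
  simp only [fourierSlice, LinearMap.coe_mk, AddHom.coe_mk, mul_sum, fourier_apply]
  rw [sum_comm]
  refine sum_congr rfl fun x _ => ?_
  simp only [mul_ite, mul_zero]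
  rw [sum_ite_eq]
  split_ifs with h
  · simp only [mul_add, sum_add_distrib, ← sum_mul, AddChar.map_add_eq_mul]
    ring
  · rw [hf x h, zero_mul]

lemma fourier_eq_zero_of_sum_notMem {χ : AddChar (ZMod n) F} (hχ : χ.IsPrimitive)
    (hn : (n : F) ≠ 0) {A : Finset (ZMod n)} {h : (Fin m → ZMod n) → F}
    {g : ZMod n → (Fin m → ZMod n) → F}
    (hg : ∀ y t, h (fun i => y i + t) = ∑ a ∈ A, χ (a * t) * g a y) {x : Fin m → ZMod n}
    (hx : ∑ i, x i ∉ A) : fourier χ⁻¹ m h x = 0 := by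
  set p := ∑ i, x i with hp
  have key : ∀ t, χ (p * t) * fourier χ⁻¹ m h x = ∑ a ∈ A, χ (a * t) * fourier χ⁻¹ m (g a) x := by
    intro t
    have h1 : fourier χ⁻¹ m h x =
        ∑ y : Fin m → ZMod n, h (fun i => y i + t) * χ⁻¹ (∑ i, (y i + t) * x i) := by
      rw [fourier_apply, ← Equiv.sum_comp (Equiv.addRight fun _ : Fin m => t)]
      rfl
    simp only [h1, fourier_apply, mul_sum, hg, sum_mul]
    rw [sum_comm]
    refine sum_congr rfl fun a _ => sum_congr rfl fun y _ => ?_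
    have h2 : χ⁻¹ (∑ i, (y i + t) * x i) = χ⁻¹ (∑ i, y i * x i) * χ (-(p * t)) := by
      rw [AddChar.inv_apply, AddChar.inv_apply, ← AddChar.map_add_eq_mul]
      simp only [add_mul, sum_add_distrib, ← mul_sum, hp]
      congr 1
      ring
    have h3 : χ (p * t) * χ (-(p * t)) = 1 := by
      rw [← AddChar.map_add_eq_mul, add_neg_cancel, AddChar.map_zero_eq_one]
    rw [h2]
    linear_combination (χ (a * t) * g a y * χ⁻¹ (∑ i, y i * x i)) * h3
  have h4 := eq_zero_of_sum_char_eq_zero hχ hn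
    (g := fun a => (if a = p then fourier χ⁻¹ m h x else 0) -
      if a ∈ A then fourier χ⁻¹ m (g a) x else 0) (fun t => ?_) p
  · simpa [hx] using h4
  · simp only [sub_mul, sum_sub_distrib, ite_mul, zero_mul, sum_ite_eq', mem_univ, if_true,
      sum_ite_mem, univ_inter]
    rw [sub_eq_zero, mul_comm, key]
    exact sum_congr rfl fun a _ => mul_comm _ _

end Fourier

section Cycles

variable {n : ℕ} [NeZero n] {F : Type*} [Field F] {m : ℕ}

/-- The chains supported on the facets of `X_A` with vanishing boundary. -/
def cycles (n : ℕ) [NeZero n] (F : Type*) [Field F] (k : ℕ) (A : Finset (ZMod n)) :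
    Submodule F (Finset (ZMod n) → F) where
  carrier := {c | bdry n F c = 0 ∧ ∀ σ, σ ∉ sumComplexFacets n k A → c σ = 0}
  add_mem' := by
    rintro c d ⟨hc, hc'⟩ ⟨hd, hd'⟩
    exact ⟨by rw [map_add, hc, hd, add_zero], fun σ hσ => by simp [hc' σ hσ, hd' σ hσ]⟩
  zero_mem' := by simp
  smul_mem' := by
    rintro r c ⟨hc, hc'⟩
    exact ⟨by rw [map_smul, hc, smul_zero], fun σ hσ => by simp [hc' σ hσ]⟩

lemma mem_span_ind_iff (S : Finset (Finset (ZMod n))) (c : Finset (ZMod n) → F) :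
    c ∈ Submodule.span F (ind n F '' (S : Set (Finset (ZMod n)))) ↔ ∀ σ, σ ∉ S → c σ = 0 := by
  constructor
  · intro hc σ hσ
    have hle : Submodule.span F (ind n F '' (S : Set (Finset (ZMod n)))) ≤
        LinearMap.ker (LinearMap.proj σ : (Finset (ZMod n) → F) →ₗ[F] F) := by
      rw [Submodule.span_le]
      rintro _ ⟨τ, hτ, rfl⟩
      have hne : σ ≠ τ := by
        rintro rfl
        exact hσ hτ
      simp [ind, hne]
    exact hle hc
  · intro hc
    have h : c = ∑ σ ∈ S, c σ • ind n F σ := by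
      funext τ
      simp only [Finset.sum_apply, Pi.smul_apply, ind, smul_eq_mul, mul_ite, mul_one, mul_zero]
      rw [sum_ite_eq]
      split_ifs with hτ
      · rfl
      · exact hc τ hτ
    rw [h]
    exact sum_mem fun σ hσ => Submodule.smul_mem _ _ (Submodule.subset_span ⟨σ, hσ, rfl⟩)

lemma hTop_eq_finrank_cycles (k : ℕ) (A : Finset (ZMod n)) :
    hTop n F k A = Module.finrank F (cycles n F k A) := by
  rw [hTop, LinearMap.ker_domRestrict, ← Submodule.finrank_map_subtype_eq,
    Submodule.map_comap_subtype]
  suffices h : Submodule.span F (ind n F '' (sumComplexFacets n k A : Set (Finset (ZMod n)))) ⊓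
      LinearMap.ker (bdry n F) = cycles n F k A by rw [h]
  ext c
  rw [Submodule.mem_inf, mem_span_ind_iff, and_comm]
  rfl

lemma mem_cycles_iff {χ : AddChar (ZMod n) F} (hχ : χ.IsPrimitive) (hn : (n : F) ≠ 0) {k : ℕ}
    {A : Finset (ZMod n)} {c : Finset (ZMod n) → F} :
    c ∈ cycles n F k A ↔ (∀ σ, σ ∉ sumComplexFacets n k A → c σ = 0) ∧
      ∀ z, fourier χ (k + 1) (chainToAlt n F (k + 1) c) (Fin.cons 0 z) = 0 := by
  rw [← sumFirst_eq_zero_iff hχ hn, and_comm]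
  refine and_congr_left fun hc => bdry_eq_zero_iff fun σ hσ => hc σ ?_
  simp [sumComplexFacets, hσ]

end Cycles

section Orbits

variable {n : ℕ} [NeZero n] {F : Type*} [Field F] {m : ℕ}

/-- The alternating function whose value at the translate by `t` of a zero-sum set `B` is
`∑ a, g B a * χ (a * t)`; here `u` is meant to be the inverse of `m` in `ℤ_n`. -/
noncomputable def orbitFun (χ : AddChar (ZMod n) F) (u : ZMod n) (A : Finset (ZMod n)) (m : ℕ) :
    ({B : Finset (ZMod n) // B.card = m ∧ ∑ x ∈ B, x = 0} → {a // a ∈ A} → F) →ₗ[F]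
      ((Fin m → ZMod n) → F) where
  toFun g := fun y => ∑ B, simplexDet F ⟨B.1, B.2.1⟩ (fun i => y i - u * ∑ j, y j) *
    ∑ a, g B a * χ (a.1 * (u * ∑ j, y j))
  map_add' g h := by
    funext y
    simp [add_mul, mul_add, sum_add_distrib]
  map_smul' r g := by
    funext y
    simp only [Pi.smul_apply, smul_eq_mul, mul_assoc, RingHom.id_apply, mul_sum]
    refine sum_congr rfl fun B _ => sum_congr rfl fun a _ => ?_
    ring

variable {χ : AddChar (ZMod n) F} {u : ZMod n} {A : Finset (ZMod n)}

lemma orbitFun_apply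
    (g : {B : Finset (ZMod n) // B.card = m ∧ ∑ x ∈ B, x = 0} → {a // a ∈ A} → F)
    (y : Fin m → ZMod n) : orbitFun χ u A m g y =
      ∑ B, simplexDet F ⟨B.1, B.2.1⟩ (fun i => y i - u * ∑ j, y j) *
        ∑ a, g B a * χ (a.1 * (u * ∑ j, y j)) := rfl

lemma orbitFun_mem_alternating
    (g : {B : Finset (ZMod n) // B.card = m ∧ ∑ x ∈ B, x = 0} → {a // a ∈ A} → F) :
    orbitFun χ u A m g ∈ alternating n F m := by
  refine ⟨fun y hy => sum_eq_zero fun B _ => ?_, fun π y => ?_⟩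
  · rw [(simplexDet_mem_alternating _).1, zero_mul]
    exact fun h => hy fun i j hij => h (by simp only [hij])
  · have hsum : ∑ j, (y ∘ π) j = ∑ j, y j := Equiv.sum_comp π y
    simp only [orbitFun_apply, hsum, mul_sum (s := univ (α := {B : Finset (ZMod n) // _}))]
    refine sum_congr rfl fun B _ => ?_
    rw [← mul_assoc, ← (simplexDet_mem_alternating _).2 π]
    rfl

omit [NeZero n] in
lemma sum_add_const (hu : (m : ZMod n) * u = 1) (y : Fin m → ZMod n) (t : ZMod n) :
    u * ∑ i, (y i + t) = u * ∑ i, y i + t := by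
  rw [sum_add_distrib, sum_const, card_univ, Fintype.card_fin, nsmul_eq_mul]
  linear_combination t * hu

lemma orbitFun_add_const (hu : (m : ZMod n) * u = 1)
    (g : {B : Finset (ZMod n) // B.card = m ∧ ∑ x ∈ B, x = 0} → {a // a ∈ A} → F)
    (y : Fin m → ZMod n) (t : ZMod n) :
    orbitFun χ u A m g (fun i => y i + t) = ∑ a ∈ A, χ (a * t) *
      if h : a ∈ A then ∑ B : {B : Finset (ZMod n) // B.card = m ∧ ∑ x ∈ B, x = 0},
        simplexDet F ⟨B.1, B.2.1⟩ (fun i => y i - u * ∑ j, y j) *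
          (g B ⟨a, h⟩ * χ (a * (u * ∑ j, y j))) else 0 := by
  rw [← sum_coe_sort A]
  simp only [coe_mem, dif_pos, orbitFun_apply, sum_add_const hu, add_sub_add_right_eq_sub,
    mul_add, AddChar.map_add_eq_mul, mul_sum]
  rw [sum_comm]
  refine sum_congr rfl fun a _ => sum_congr rfl fun B _ => ?_
  ring

lemma orbitFun_cons_zero
    {g : {B : Finset (ZMod n) // B.card = m + 1 ∧ ∑ x ∈ B, x = 0} → {a // a ∈ A} → F}
    (hg : ∀ B, ∀ b ∈ B.1, ∑ a, χ (-(a.1 * b)) * g B a = 0) (z : Fin m → ZMod n) :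
    orbitFun χ u A (m + 1) g (Fin.cons 0 z) = 0 := by
  set y : Fin (m + 1) → ZMod n := Fin.cons 0 z with hy
  refine sum_eq_zero fun B _ => ?_
  by_cases h : simplexDet F ⟨B.1, B.2.1⟩ (fun i => y i - u * ∑ j, y j) = 0
  · rw [h, zero_mul]
  · obtain ⟨π, hπ⟩ := exists_perm_of_simplexDet_ne_zero h
    have h0 : 0 - u * ∑ j, y j = enum ⟨B.1, B.2.1⟩ (π 0) := congrFun hπ 0
    have hb := hg B (0 - u * ∑ j, y j) (h0 ▸ enum_mem ⟨B.1, B.2.1⟩ (π 0))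
    simp only [zero_sub, mul_neg, neg_neg] at hb
    simp only [mul_comm (g B _), hb, mul_zero]

lemma orbitFun_injective (hχ : χ.IsPrimitive) (hn : (n : F) ≠ 0) (hu : (m : ZMod n) * u = 1) :
    Function.Injective (orbitFun χ u A m) := by
  rw [injective_iff_map_eq_zero]
  intro g hg
  funext B a
  have key : ∀ t, ∑ a, g B a * χ (a.1 * t) = 0 := by
    intro t
    have hsum : ∑ i, enum ⟨B.1, B.2.1⟩ i = 0 := (sum_enum ⟨B.1, B.2.1⟩ fun x => x).trans B.2.2
    have h := congrFun hg fun i => enum ⟨B.1, B.2.1⟩ i + t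
    simpa [orbitFun_apply, sum_add_const hu, hsum, simplexDet_enum, ← Subtype.ext_iff] using h
  have h := eq_zero_of_sum_char_eq_zero hχ hn (g := fun a => if h : a ∈ A then g B ⟨a, h⟩ else 0)
    (fun t => ?_) a.1
  · simpa using h
  · refine Eq.trans ?_ (key t)
    rw [← sum_subset (subset_univ A) fun a _ ha => by rw [dif_neg ha, zero_mul], ← sum_coe_sort A]
    simp

end Orbits

section Homology

variable {n : ℕ} [NeZero n] {F : Type*} [Field F] {ω : F} {χ : AddChar (ZMod n) F}

lemma mem_ker_transpose_iff (hω : ∀ a, χ a = ω ^ a.val) {A B : Finset (ZMod n)}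
    {g : {a // a ∈ A} → F} :
    g ∈ LinearMap.ker (fourierSubmatrix n F ω A B).transpose.mulVecLin ↔
      ∀ b ∈ B, ∑ a : {a // a ∈ A}, χ (-(a.1 * b)) * g a = 0 := by
  rw [LinearMap.mem_ker, funext_iff, Subtype.forall]
  simp only [hω]
  rfl

lemma finrank_cycles (hχ : χ.IsPrimitive) (hn : (n : F) ≠ 0) (hω : ∀ a, χ a = ω ^ a.val) {k : ℕ}
    {u : ZMod n} (hu : ((k + 1 : ℕ) : ZMod n) * u = 1) (A : Finset (ZMod n)) :
    Module.finrank F (cycles n F k A) =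
      ∑ B : {B : Finset (ZMod n) // B.card = k + 1 ∧ ∑ x ∈ B, x = 0},
        Module.finrank F (LinearMap.ker (fourierSubmatrix n F ω A B.1).transpose.mulVecLin) := by
  let K (B : {B : Finset (ZMod n) // B.card = k + 1 ∧ ∑ x ∈ B, x = 0}) :=
    LinearMap.ker (fourierSubmatrix n F ω A B.1).transpose.mulVecLin
  have hsupp : ∀ c ∈ cycles n F k A, ∀ x : Fin (k + 1) → ZMod n, ∑ i, x i ∉ A →
      chainToAlt n F (k + 1) c x = 0 := fun c hc x hx =>
    chainToAlt_eq_zero_of_sum_notMem (fun σ hσ => hc.2 σ (by simp [sumComplexFacets, hσ])) hx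
  have hker : ∀ B, ∀ c : cycles n F k A,
      (LinearMap.pi fun a : {a // a ∈ A} => fourierSlice χ (k + 1) a.1 (enum ⟨B.1, B.2.1⟩) ∘ₗ
        chainToAlt n F (k + 1) ∘ₗ (cycles n F k A).subtype) c ∈ K B := by
    rintro B ⟨c, hc⟩
    refine (mem_ker_transpose_iff hω).2 fun b hb => ?_
    obtain ⟨i, hi⟩ := exists_enum_eq ⟨B.1, B.2.1⟩ hb
    have h := fourier_add_const χ (hsupp c hc) (enum ⟨B.1, B.2.1⟩) (-b)
    rw [alternating_apply_eq_zero (fourier_mem_alternating χ (chainToAlt_mem_alternating c))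
      ((mem_cycles_iff hχ hn).1 hc).2 (i := i) (by rw [hi, add_neg_cancel]),
      ← sum_coe_sort A] at h
    simp only [mul_neg] at h
    exact h.symm
  let Φ : cycles n F k A →ₗ[F] (B : _) → K B :=
    LinearMap.pi fun B => LinearMap.codRestrict (K B) _ (hker B)
  have hΦ : Function.Injective Φ := by
    rw [injective_iff_map_eq_zero]
    rintro ⟨c, hc⟩ h0
    have hslice : ∀ B : {B : Finset (ZMod n) // B.card = k + 1 ∧ ∑ x ∈ B, x = 0}, ∀ a ∈ A,
        fourierSlice χ (k + 1) a (enum ⟨B.1, B.2.1⟩) (chainToAlt n F (k + 1) c) = 0 :=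
      fun B a ha => congrFun (congrArg Subtype.val (congrFun h0 B)) ⟨a, ha⟩
    have hfour : fourier χ (k + 1) (chainToAlt n F (k + 1) c) = 0 := by
      have halt := fourier_mem_alternating χ (chainToAlt_mem_alternating (m := k + 1) c)
      funext y
      by_cases hy : Function.Injective y
      · obtain ⟨σ, π, hσ⟩ := exists_perm_enum (x := fun i => y i + -(u * ∑ j, y j))
          fun i j hij => hy (add_right_cancel hij)
        have hsum : ∑ x ∈ σ.1, x = 0 := by
          rw [← sum_enum σ fun x => x, ← Equiv.sum_comp π]
          change ∑ i, (enum σ ∘ π) i = 0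
          rw [← hσ, sum_add_distrib, sum_const, card_univ, Fintype.card_fin, nsmul_eq_mul]
          linear_combination (-∑ j, y j) * hu
        have hy' : y = (fun i => enum σ i + u * ∑ j, y j) ∘ π := by
          funext i
          have := congrFun hσ i
          simp only [Function.comp_apply] at this ⊢
          rw [← this, neg_add_cancel_right]
        rw [hy', halt.2, fourier_add_const χ (hsupp c hc), sum_eq_zero, mul_zero, Pi.zero_apply]
        intro a ha
        rw [hslice ⟨σ.1, σ.2, hsum⟩ a ha, mul_zero]
      · exact halt.1 y hy
    apply Subtype.ext
    funext σ
    by_cases hσ : σ.card = k + 1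
    · have h := chainToAlt_enum c ⟨σ, hσ⟩
      rw [fourier_eq_zero hχ hn hfour] at h
      exact h.symm
    · exact hc.2 σ (by simp [sumComplexFacets, hσ])
  have hχ' : χ⁻¹.IsPrimitive := isPrimitive_inv hχ
  let incl : ((B : _) → K B) →ₗ[F]
      ({B : Finset (ZMod n) // B.card = k + 1 ∧ ∑ x ∈ B, x = 0} → {a // a ∈ A} → F) :=
    LinearMap.pi fun B => (K B).subtype ∘ₗ LinearMap.proj B
  let Ψ₀ := altToChain n F (k + 1) ∘ₗ fourier χ⁻¹ (k + 1) ∘ₗ orbitFun χ u A (k + 1) ∘ₗ incl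
  have halt : ∀ g, fourier χ⁻¹ (k + 1) (orbitFun χ u A (k + 1) g) ∈ alternating n F (k + 1) :=
    fun g => fourier_mem_alternating χ⁻¹ (orbitFun_mem_alternating g)
  have hmem : ∀ g, Ψ₀ g ∈ cycles n F k A := by
    intro g
    refine (mem_cycles_iff hχ hn).2 ⟨fun σ hσ => ?_, fun z => ?_⟩
    · by_cases hcard : σ.card = k + 1
      · have hA : ∑ i, enum ⟨σ, hcard⟩ i ∉ A := by
          rw [sum_enum ⟨σ, hcard⟩ fun x => x]
          simpa [sumComplexFacets, hcard] using hσ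
        exact (altToChain_apply _ ⟨σ, hcard⟩).trans
          (fourier_eq_zero_of_sum_notMem hχ hn (orbitFun_add_const hu _) hA)
      · exact altToChain_apply_of_card_ne _ hcard
    · have h := fourier_inv_fourier hχ' (orbitFun χ u A (k + 1) (incl g))
      rw [inv_inv] at h
      change fourier χ (k + 1) (chainToAlt n F (k + 1) (altToChain n F (k + 1)
        (fourier χ⁻¹ (k + 1) (orbitFun χ u A (k + 1) (incl g))))) _ = 0
      rw [chainToAlt_altToChain (halt _)]
      refine (congrFun h _).trans ?_
      rw [Pi.smul_apply, orbitFun_cons_zero, smul_zero]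
      exact fun B => (mem_ker_transpose_iff hω).1 (g B).2
  have hΨ : Function.Injective (Ψ₀.codRestrict _ hmem) := by
    rw [injective_iff_map_eq_zero]
    intro g h0
    have h1 : altToChain n F (k + 1) (fourier χ⁻¹ (k + 1) (orbitFun χ u A (k + 1) (incl g))) = 0 :=
      congrArg Subtype.val h0
    have h2 := chainToAlt_altToChain (halt (incl g))
    rw [h1, map_zero] at h2
    have h3 := orbitFun_injective hχ hn hu
      ((fourier_eq_zero hχ' hn h2.symm).trans (map_zero (orbitFun χ u A (k + 1))).symm)
    funext B
    exact Subtype.ext (congrFun h3 B)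
  rw [← Module.finrank_pi_fintype F]
  exact le_antisymm (LinearMap.finrank_le_finrank_of_injective hΦ)
    (LinearMap.finrank_le_finrank_of_injective hΨ)

lemma rank_add_finrank_ker {ι κ : Type*} [Fintype ι] [Fintype κ] [DecidableEq κ]
    (M : Matrix ι κ F) :
    M.rank + Module.finrank F (LinearMap.ker M.mulVecLin) = Fintype.card κ := by
  rw [Matrix.rank, LinearMap.finrank_range_add_finrank_ker, Module.finrank_fintype_fun_eq_card]

lemma finrank_ker_transpose {A B : Finset (ZMod n)} (h : A.card = B.card) :
    Module.finrank F (LinearMap.ker (fourierSubmatrix n F ω A B).transpose.mulVecLin) =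
      Module.finrank F (LinearMap.ker (fourierSubmatrix n F ω A B).mulVecLin) := by
  have h1 := rank_add_finrank_ker (fourierSubmatrix n F ω A B)
  have h2 := rank_add_finrank_ker (fourierSubmatrix n F ω A B).transpose
  rw [Matrix.rank_transpose] at h2
  rw [Fintype.card_coe] at h1 h2
  omega

lemma finrank_ker_translate (hω : ∀ a, χ a = ω ^ a.val) (A B : Finset (ZMod n)) (t : ZMod n) :
    Module.finrank F (LinearMap.ker
      (fourierSubmatrix n F ω A (B.map (Equiv.addRight t).toEmbedding)).mulVecLin) =
      Module.finrank F (LinearMap.ker (fourierSubmatrix n F ω A B).mulVecLin) := by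
  let e : {b // b ∈ B} ≃ {b // b ∈ B.map (Equiv.addRight t).toEmbedding} :=
    (Equiv.addRight t).subtypeEquiv fun b => by simp
  have hM : (fourierSubmatrix n F ω A (B.map (Equiv.addRight t).toEmbedding)).submatrix
      (Equiv.refl _) e =
      Matrix.diagonal (fun a : {a // a ∈ A} => χ (-(a.1 * t))) * fourierSubmatrix n F ω A B := by
    ext a b
    rw [Matrix.diagonal_mul]
    change ω ^ (-(a.1 * (b.1 + t))).val = χ (-(a.1 * t)) * ω ^ (-(a.1 * b.1)).val
    rw [← hω, ← hω, ← AddChar.map_add_eq_mul]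
    congr 1
    ring
  have hdet : IsUnit (Matrix.diagonal fun a : {a // a ∈ A} => χ (-(a.1 * t))).det := by
    rw [Matrix.det_diagonal, isUnit_iff_ne_zero, prod_ne_zero_iff]
    exact fun a _ => (χ.val_isUnit _).ne_zero
  have h1 := rank_add_finrank_ker (fourierSubmatrix n F ω A B)
  have h2 := rank_add_finrank_ker
    (fourierSubmatrix n F ω A (B.map (Equiv.addRight t).toEmbedding))
  rw [← Matrix.rank_submatrix _ (Equiv.refl _) e, hM,
    Matrix.rank_mul_eq_right_of_isUnit_det _ _ hdet] at h2
  rw [Fintype.card_coe] at h1 h2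
  rw [card_map] at h2
  omega

lemma sum_translate (m : ℕ) {u : ZMod n} (hu : (m : ZMod n) * u = 1) {d : Finset (ZMod n) → ℕ}
    (hd : ∀ B t, d (B.map (Equiv.addRight t).toEmbedding) = d B) :
    m * ∑ B : {B : Finset (ZMod n) // B.card = m ∧ ∑ x ∈ B, x = 0}, d B.1 =
      ∑ B ∈ univ.filter (fun B : Finset (ZMod n) => B.card = m ∧ (0 : ZMod n) ∈ B), d B := by
  have hsum : ∀ (B : Finset (ZMod n)) t, B.card = m →
      ∑ x ∈ B.map (Equiv.addRight t).toEmbedding, x = ∑ x ∈ B, x + m * t := by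
    intro B t hB
    simp [sum_add_distrib, hB]
  have h1 : m * ∑ B : {B : Finset (ZMod n) // B.card = m ∧ ∑ x ∈ B, x = 0}, d B.1 =
      ∑ B ∈ univ.filter (fun B : Finset (ZMod n) => B.card = m ∧ ∑ x ∈ B, x = 0),
        ∑ _b ∈ B, d B := by
    rw [sum_subtype (univ.filter fun B : Finset (ZMod n) => B.card = m ∧ ∑ x ∈ B, x = 0)
      (p := fun B => B.card = m ∧ ∑ x ∈ B, x = 0) (by simp), mul_sum]
    exact sum_congr rfl fun B _ => by rw [sum_const, B.2.1, smul_eq_mul]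
  rw [h1, sum_sigma']
  refine sum_bij' (fun p _ => p.1.map (Equiv.addRight (-p.2)).toEmbedding)
    (fun C _ => ⟨C.map (Equiv.addRight (-(u * ∑ x ∈ C, x))).toEmbedding, -(u * ∑ x ∈ C, x)⟩)
    ?_ ?_ ?_ ?_ ?_
  · rintro ⟨B, b⟩ h
    simp only [mem_sigma, mem_filter, mem_univ, true_and] at h
    simp only [mem_filter, mem_univ, true_and, card_map, h.1.1]
    exact mem_map.2 ⟨b, h.2, add_neg_cancel b⟩
  · intro C h
    simp only [mem_filter, mem_univ, true_and] at h
    simp only [mem_sigma, mem_filter, mem_univ, true_and, card_map, h.1, hsum C _ h.1]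
    refine ⟨by linear_combination (-∑ x ∈ C, x) * hu, mem_map.2 ⟨0, h.2, zero_add _⟩⟩
  · rintro ⟨B, b⟩ h
    simp only [mem_sigma, mem_filter, mem_univ, true_and] at h
    have hb : -(u * ∑ x ∈ B.map (Equiv.addRight (-b)).toEmbedding, x) = b := by
      rw [hsum B _ h.1.1, h.1.2]
      linear_combination b * hu
    simp only [hb, map_map]
    congr 1
    ext x
    simp
  · intro C h
    simp only [map_map]
    ext x
    simp
  · rintro ⟨B, b⟩ h
    exact (hd B _).symm

end Homology

end SumComplex

/-- `h_k(X_A;F) = (1/(k+1)) ∑_{B ∈ B_{n,k}} dim ker M_{A,B}`, where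
`B_{n,k}` is the family of `(k+1)`-element subsets of `ℤ_n` containing `0`. -/
theorem sum_complex_homology (n k : ℕ) [NeZero n] (hk : 0 < k)
    (hcop : Nat.Coprime (k + 1) n) (A : Finset (ZMod n)) (hA : A.card = k + 1)
    (F : Type*) [Field F] (hchar : ¬ (ringChar F ∣ n)) (ω : F)
    (hω : IsPrimitiveRoot ω n) :
    (k + 1) * hTop n F k A =
      ∑ B ∈ Finset.univ.filter
          (fun B : Finset (ZMod n) => B.card = k + 1 ∧ (0 : ZMod n) ∈ B),
        Module.finrank F (LinearMap.ker (fourierSubmatrix n F ω A B).mulVecLin) := by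
  have hn : (n : F) ≠ 0 := fun h => hchar ((ringChar.spec F n).1 h)
  have hu := ZMod.coe_mul_inv_eq_one (k + 1) hcop
  rw [SumComplex.hTop_eq_finrank_cycles,
    SumComplex.finrank_cycles (AddChar.zmodChar_primitive_of_primitive_root n hω) hn
      (AddChar.zmodChar_apply hω.pow_eq_one) hu,
    ← SumComplex.sum_translate (k + 1) hu
      (SumComplex.finrank_ker_translate (AddChar.zmodChar_apply hω.pow_eq_one) A)]
  congr 1
  exact Finset.sum_congr rfl fun B _ =>
    SumComplex.finrank_ker_transpose (hA.trans B.2.1.symm)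
end

section
/- Let n be a prime, let k be a positive integer with k+1 < n, and let A ⊆ ℤ_n with |A| = k+1. Then the boundaries {∂σ : σ a facet of X_A} are linearly independent over ℚ; consequently h_k(X_A;ℚ) = 0 and, since X_A has C(n−1,k) facets and contains the full (k−1)-skeleton, X_A is a k-hypertree. -/
open scoped BigOperators

section Chebotarev

open Polynomial

theorem sub_one_pow_dvd_sum_natCast_pow {Q ι : Type*} [CommRing Q] (s : Finset ι) (G : ι → Q)
    (e : ι → ℕ) {m : ℕ} (h : (X - C (1 : Q)) ^ m ∣ ∑ a ∈ s, C (G a) * X ^ e a) (j : ℕ) :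
    (X - C (1 : Q)) ^ (m - j) ∣ ∑ a ∈ s, C (G a * (e a : Q) ^ j) * X ^ e a := by
  induction j with
  | zero => simpa using h
  | succ j ih =>
    have hd := (pow_sub_one_dvd_derivative_of_pow_dvd ih).mul_left X
    rw [Nat.sub_sub] at hd
    convert hd using 1
    rw [derivative_sum, Finset.mul_sum]
    refine Finset.sum_congr rfl fun a _ => ?_
    rw [derivative_C_mul_X_pow]
    rcases Nat.eq_zero_or_pos (e a) with h0 | h0
    · simp [h0]
    · rw [mul_left_comm, ← pow_succ', Nat.sub_add_cancel h0, pow_succ, mul_assoc]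

/-- A nonzero polynomial of degree less than `p` in characteristic `p` with a root of
multiplicity `m` at `1` has more than `m` nonzero coefficients. -/
theorem coeff_eq_zero_of_sub_one_pow_dvd {Q : Type*} [CommRing Q] [IsDomain Q] {p : ℕ} [NeZero p]
    [CharP Q p] (A : Finset (ZMod p)) (G : ZMod p → Q)
    (h : (X - C (1 : Q)) ^ A.card ∣ ∑ a ∈ A, C (G a) * X ^ a.val) : ∀ a ∈ A, G a = 0 := by
  have hsum (j : Fin A.card) :
      ∑ i, G (A.equivFin.symm i) * ((A.equivFin.symm i : ZMod p).val : Q) ^ (j : ℕ) = 0 := by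
    rw [Equiv.sum_comp A.equivFin.symm fun a : A => G a * ((a : ZMod p).val : Q) ^ (j : ℕ),
      Finset.sum_coe_sort A fun a => G a * (a.val : Q) ^ (j : ℕ)]
    have hdvd := (dvd_pow_self (X - C (1 : Q)) (Nat.sub_ne_zero_of_lt j.2)).trans
      (sub_one_pow_dvd_sum_natCast_pow A G ZMod.val h j)
    simpa [eval_finsetSum] using dvd_iff_isRoot.mp hdvd
  have hinj : Function.Injective fun i => ((A.equivFin.symm i : ZMod p).val : Q) := by
    intro i j hij
    refine A.equivFin.symm.injective (Subtype.ext (ZMod.val_injective p ?_))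
    exact CharP.natCast_injOn_Iio Q p (ZMod.val_lt _) (ZMod.val_lt _) hij
  intro a ha
  simpa using congrFun (Matrix.eq_zero_of_forall_pow_sum_mul_pow_eq_zero hinj hsum)
    (A.equivFin ⟨a, ha⟩)

variable {R : Type*} [CommRing R] [IsDomain R] {p : ℕ} [NeZero p] {π ζ : R}

theorem prime_dvd_of_sum_mul_pow_eq_zero (hp : p.Prime) (hζ : IsPrimitiveRoot ζ p) (hπ : Prime π)
    (hπζ : π ∣ ζ - 1) (hπp : π ∣ p) {A T : Finset (ZMod p)} (hAT : A.card = T.card)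
    (G : ZMod p → R) (h : ∀ t ∈ T, ∑ a ∈ A, G a * ζ ^ (t.val * a.val) = 0) :
    ∀ a ∈ A, π ∣ G a := by
  set I := Ideal.span {π}
  have : I.IsPrime := (Ideal.span_singleton_prime hπ.ne_zero).mpr hπ
  have : CharP (R ⧸ I) p := by
    refine (CharP.charP_iff_prime_eq_zero hp).mpr ?_
    rw [← map_natCast (Ideal.Quotient.mk I), Ideal.Quotient.eq_zero_iff_mem]
    exact Ideal.mem_span_singleton.mpr hπp
  have hζ1 : Ideal.Quotient.mk I ζ = 1 := by
    rw [← map_one (Ideal.Quotient.mk I), Ideal.Quotient.eq]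
    exact Ideal.mem_span_singleton.mpr hπζ
  have hdvd : ∏ t ∈ T, (X - C (ζ ^ t.val)) ∣ ∑ a ∈ A, C (G a) * X ^ a.val := by
    by_cases hg : ∑ a ∈ A, C (G a) * X ^ a.val = 0
    · simp [hg]
    have hinj : Function.Injective fun t : ZMod p => ζ ^ t.val := fun s t hst =>
      ZMod.val_injective p (hζ.pow_inj (ZMod.val_lt _) (ZMod.val_lt _) hst)
    have hle := (Multiset.prod_X_sub_C_dvd_iff_le_roots hg (T.val.map fun t => ζ ^ t.val)).mpr
      ((Multiset.le_iff_subset (T.nodup.map hinj)).mpr fun x hx => by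
        obtain ⟨t, ht, rfl⟩ := Multiset.mem_map.mp hx
        rw [mem_roots hg, IsRoot, eval_finsetSum]
        simpa [pow_mul] using h t ht)
    rwa [Multiset.map_map] at hle
  intro a ha
  rw [← Ideal.mem_span_singleton, ← Ideal.Quotient.eq_zero_iff_mem]
  refine coeff_eq_zero_of_sub_one_pow_dvd A (fun a => Ideal.Quotient.mk I (G a)) ?_ a ha
  simpa [Polynomial.map_prod, Polynomial.map_sum, hζ1, hAT] using
    Polynomial.map_dvd (Ideal.Quotient.mk I) hdvd

theorem eq_zero_of_sum_mul_pow_eq_zero_of_prime [WfDvdMonoid R] (hp : p.Prime)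
    (hζ : IsPrimitiveRoot ζ p) (hπ : Prime π) (hπζ : π ∣ ζ - 1) (hπp : π ∣ p)
    {A T : Finset (ZMod p)} (hAT : A.card = T.card)
    (G : ZMod p → R) (h : ∀ t ∈ T, ∑ a ∈ A, G a * ζ ^ (t.val * a.val) = 0) :
    ∀ a ∈ A, G a = 0 := by
  have hpow (N : ℕ) : ∀ G : ZMod p → R,
      (∀ t ∈ T, ∑ a ∈ A, G a * ζ ^ (t.val * a.val) = 0) → ∀ a ∈ A, π ^ N ∣ G a := by
    induction N with
    | zero => simp
    | succ N ih =>
      intro G h a ha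
      choose! H hH using prime_dvd_of_sum_mul_pow_eq_zero hp hζ hπ hπζ hπp hAT G h
      rw [hH a ha, pow_succ']
      refine mul_dvd_mul_left π (ih H (fun t ht => ?_) a ha)
      refine (mul_eq_zero.mp ?_).resolve_left hπ.ne_zero
      rw [Finset.mul_sum, ← h t ht]
      exact Finset.sum_congr rfl fun b hb => by rw [hH b hb, mul_assoc]
  intro a ha
  by_contra hne
  obtain ⟨N, hN⟩ := FiniteMultiplicity.of_not_isUnit hπ.not_isUnit hne
  exact hN (hpow (N + 1) G h a ha)

/-- Chebotarëv's theorem on roots of unity: all minors of the Fourier matrix of prime order are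
nonzero. -/
theorem eq_zero_of_sum_mul_pow_eq_zero {K : Type*} [Field K] [NumberField K]
    [IsCyclotomicExtension {p} ℚ K] (hp : p.Prime) {ζ : K} (hζ : IsPrimitiveRoot ζ p)
    {A T : Finset (ZMod p)} (hAT : A.card = T.card) (G : ZMod p → K)
    (h : ∀ t ∈ T, ∑ a ∈ A, G a * ζ ^ (t.val * a.val) = 0) : ∀ a ∈ A, G a = 0 := by
  have : Fact p.Prime := ⟨hp⟩
  obtain ⟨b, hb⟩ := IsLocalization.exist_integer_multiples_of_finite
    (nonZeroDivisors (NumberField.RingOfIntegers K)) G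
  choose H hH using hb
  have hb0 : algebraMap (NumberField.RingOfIntegers K) K b ≠ 0 := by simp
  intro a ha
  have hHa : H a = 0 := by
    refine eq_zero_of_sum_mul_pow_eq_zero_of_prime hp hζ.toInteger_isPrimitiveRoot
      hζ.zeta_sub_one_prime' dvd_rfl hζ.toInteger_sub_one_dvd_prime' hAT H (fun t ht => ?_) a ha
    apply FaithfulSMul.algebraMap_injective (NumberField.RingOfIntegers K) K
    rw [map_sum, map_zero, ← mul_zero (algebraMap _ K (b : NumberField.RingOfIntegers K)),
      ← h t ht, Finset.mul_sum]
    refine Finset.sum_congr rfl fun c _ => ?_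
    rw [map_mul, hH, map_pow, Algebra.smul_def, mul_assoc]
    rfl
  have := hH a
  rw [hHa, map_zero, Algebra.smul_def] at this
  exact (mul_eq_zero.mp this.symm).resolve_left hb0

end Chebotarev

section Orientation

variable {n : ℕ} [NeZero n] {m : ℕ}

theorem bdry_apply_eq_sum (F : Type*) [Field F] (c : Finset (ZMod n) → F) (τ : Finset (ZMod n)) :
    bdry n F c τ = ∑ x ∈ τᶜ, c (insert x τ) * (-1) ^ (τ.filter (fun y => y.val < x.val)).card := by
  change ∑ σ, c σ * bdryCoeff n F σ τ = _
  have hinner (x : ZMod n) : ∑ σ : Finset (ZMod n), (if x ∈ σ ∧ τ = σ.erase x then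
      c σ * (-1) ^ (σ.filter (fun y => y.val < x.val)).card else 0) =
      if x ∈ τᶜ then c (insert x τ) * (-1) ^ (τ.filter (fun y => y.val < x.val)).card else 0 := by
    by_cases hx : x ∈ τ
    · rw [if_neg (by simpa using hx)]
      refine Finset.sum_eq_zero fun σ _ => if_neg ?_
      rintro ⟨-, rfl⟩
      simp at hx
    · rw [if_pos (by simpa using hx), Finset.sum_eq_single (insert x τ)]
      · rw [if_pos ⟨Finset.mem_insert_self _ _, (Finset.erase_insert hx).symm⟩,
          Finset.filter_insert, if_neg (lt_irrefl _)]
      · rintro σ - hσ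
        refine if_neg ?_
        rintro ⟨hxσ, rfl⟩
        exact hσ (Finset.insert_erase hxσ).symm
      · simp
  rw [← Fintype.sum_ite_mem τᶜ, ← Finset.sum_congr rfl fun x _ => hinner x, Finset.sum_comm]
  refine Finset.sum_congr rfl fun σ _ => ?_
  simp only [bdryCoeff, Finset.mul_sum, mul_ite, mul_zero, ite_and]
  rw [Fintype.sum_ite_mem]

/-- The sign of the permutation sorting the tuple `x`, and `0` if `x` has repeated entries. -/
def tupleSign (x : Fin m → ZMod n) : ℤ :=
  (Matrix.vandermonde fun i => ((x i).val : ℤ)).det.sign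

theorem tupleSign_comp_perm (x : Fin m → ZMod n) (e : Equiv.Perm (Fin m)) :
    tupleSign (x ∘ e) = Equiv.Perm.sign e * tupleSign x := by
  have h : Matrix.vandermonde (fun i => ((x (e i)).val : ℤ)) =
      (Matrix.vandermonde fun i => ((x i).val : ℤ)).submatrix e id := rfl
  rcases Int.units_eq_one_or (Equiv.Perm.sign e) with he | he <;>
    simp only [tupleSign, Function.comp_apply, h, Matrix.det_permute, he] <;> simp

theorem tupleSign_ne_zero_iff {x : Fin m → ZMod n} :
    tupleSign x ≠ 0 ↔ Function.Injective x := by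
  rw [tupleSign, Ne, Int.sign_eq_zero_iff_zero, ← Ne, Matrix.det_vandermonde_ne_zero_iff]
  exact ⟨fun h i j hij => h (by simp [hij]),
    fun h i j hij => h (ZMod.val_injective n (Nat.cast_injective hij))⟩

theorem Int.sign_prod {ι : Type*} (s : Finset ι) (f : ι → ℤ) :
    (∏ i ∈ s, f i).sign = ∏ i ∈ s, (f i).sign := by
  classical
  induction s using Finset.induction_on with
  | empty => simp
  | insert a s ha ih => rw [Finset.prod_insert ha, Finset.prod_insert ha, Int.sign_mul, ih]

theorem tupleSign_cons (a : ZMod n) {y : Fin m → ZMod n} (hy : Function.Injective y)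
    (ha : a ∉ Finset.univ.image y) :
    tupleSign (Fin.cons a y : Fin (m + 1) → ZMod n) =
      (-1) ^ ((Finset.univ.image y).filter (fun b => b.val < a.val)).card * tupleSign y := by
  have h : (∏ j, (((y j).val : ℤ) - a.val)).sign =
      (-1) ^ ((Finset.univ.image y).filter (fun b => b.val < a.val)).card := by
    rw [Int.sign_prod, ← Finset.prod_image (g := y) (f := fun b => ((b.val : ℤ) - a.val).sign)
      hy.injOn, ← Finset.prod_const, Finset.prod_filter]
    refine Finset.prod_congr rfl fun b hb => ?_
    have hne : b.val ≠ a.val := fun hba => ha (ZMod.val_injective n hba ▸ hb)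
    split_ifs with hlt
    · exact Int.sign_eq_neg_one_of_neg (by omega)
    · exact Int.sign_eq_one_of_pos (by omega)
  rw [tupleSign, Matrix.det_vandermonde, Fin.prod_univ_succ, Int.sign_mul, Fin.prod_Ioi_zero]
  simp only [Fin.prod_Ioi_succ, Fin.cons_zero, Fin.cons_succ]
  rw [h, ← Matrix.det_vandermonde fun i => ((y i).val : ℤ)]
  rfl

/-- The alternating function on tuples corresponding to a simplicial chain. -/
def altChain {F : Type*} [Field F] (c : Finset (ZMod n) → F) (x : Fin m → ZMod n) : F :=
  tupleSign x * c (Finset.univ.image x)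

variable {F : Type*} [Field F]

theorem altChain_comp_perm (c : Finset (ZMod n) → F) (x : Fin m → ZMod n)
    (e : Equiv.Perm (Fin m)) :
    altChain c (x ∘ e) = (Equiv.Perm.sign e : ℤ) * altChain c x := by
  have himage : Finset.univ.image (x ∘ e) = Finset.univ.image x := by
    rw [← Finset.image_image, Finset.image_univ_equiv]
  rw [altChain, himage, tupleSign_comp_perm, altChain, Int.cast_mul, mul_assoc]

theorem sum_altChain_cons (c : Finset (ZMod n) → F) (y : Fin m → ZMod n) :
    ∑ a, altChain c (Fin.cons a y : Fin (m + 1) → ZMod n) =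
      tupleSign y * bdry n F c (Finset.univ.image y) := by
  have hzero (a : ZMod n) (h : ¬ (Function.Injective y ∧ a ∉ Finset.univ.image y)) :
      altChain c (Fin.cons a y : Fin (m + 1) → ZMod n) = 0 := by
    have : tupleSign (Fin.cons a y : Fin (m + 1) → ZMod n) = 0 := by
      by_contra hne
      rw [← Ne, tupleSign_ne_zero_iff, Fin.cons_injective_iff] at hne
      exact h ⟨hne.2, by simpa using hne.1⟩
    simp [altChain, this]
  by_cases hy : Function.Injective y
  · rw [bdry_apply_eq_sum, Finset.mul_sum]
    symm
    refine (Finset.sum_congr rfl fun a ha => ?_).trans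
      (Finset.sum_subset (Finset.subset_univ _) fun a _ ha => hzero a fun h => ?_)
    · have himage : Finset.univ.image (Fin.cons a y : Fin (m + 1) → ZMod n) =
          insert a (Finset.univ.image y) := by
        ext b
        simp [Fin.exists_fin_succ, eq_comm]
      rw [altChain, himage, tupleSign_cons a hy (Finset.mem_compl.mp ha)]
      push_cast
      ring
    · exact ha (Finset.mem_compl.mpr h.2)
  · rw [Finset.sum_eq_zero fun a _ => hzero a fun h => hy h.1,
      not_not.mp (mt tupleSign_ne_zero_iff.mp hy)]
    simp

end Orientation

section Fourier

theorem AddChar.map_sum_eq_prod {ι G M : Type*} [AddCommMonoid G] [CommMonoid M]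
    (ψ : AddChar G M) (s : Finset ι) (f : ι → G) : ψ (∑ i ∈ s, f i) = ∏ i ∈ s, ψ (f i) := by
  classical
  induction s using Finset.induction_on with
  | empty => simp
  | insert a s ha ih =>
    rw [Finset.sum_insert ha, Finset.prod_insert ha, AddChar.map_add_eq_mul, ih]

variable {n : ℕ} [NeZero n] {m : ℕ} {K : Type*} [Field K]

/-- The Fourier transform of a function on `m`-tuples with respect to a character `ψ`. -/
def tupleFourier (ψ : AddChar (ZMod n) K) (f : (Fin m → ZMod n) → K) (s : Fin m → ZMod n) : K :=
  ∑ x, f x * ψ (∑ i, s i * x i)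

theorem eq_zero_of_tupleFourier_eq_zero [CharZero K] {ψ : AddChar (ZMod n) K}
    (hψ : ψ.IsPrimitive) {f : (Fin m → ZMod n) → K} (h : ∀ s, tupleFourier ψ f s = 0) : f = 0 := by
  funext y
  have horth (x : Fin m → ZMod n) :
      ∑ s : Fin m → ZMod n, ψ (∑ i, s i * x i) * ψ (-∑ i, s i * y i) =
        if x = y then (n : K) ^ m else 0 := by
    have hprod (s : Fin m → ZMod n) :
        ψ (∑ i, s i * x i) * ψ (-∑ i, s i * y i) = ∏ i, ψ (s i * (x i - y i)) := by
      rw [← AddChar.map_add_eq_mul, ← AddChar.map_sum_eq_prod, ← sub_eq_add_neg,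
        ← Finset.sum_sub_distrib]
      simp only [mul_sub]
    simp only [hprod]
    rw [← Fintype.piFinset_univ, ← Finset.prod_univ_sum (fun _ => Finset.univ)
      fun i t => ψ (t * (x i - y i))]
    simp only [AddChar.sum_mulShift _ hψ, sub_eq_zero, ZMod.card]
    split_ifs with hxy
    · simp [hxy]
    · obtain ⟨i, hi⟩ := Function.ne_iff.mp hxy
      exact Finset.prod_eq_zero (Finset.mem_univ i) (by simp [hi])
  have hinv : ∑ s, tupleFourier ψ f s * ψ (-∑ i, s i * y i) = f y * (n : K) ^ m := by
    simp only [tupleFourier, Finset.sum_mul]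
    rw [Finset.sum_comm]
    simp only [mul_assoc, ← Finset.mul_sum, horth]
    simp
  simp only [h, zero_mul, Finset.sum_const_zero] at hinv
  exact (mul_eq_zero.mp hinv.symm).resolve_right (pow_ne_zero _ (NeZero.ne _))

variable (ψ : AddChar (ZMod n) K) (c : Finset (ZMod n) → K)

theorem tupleFourier_altChain_comp_perm (s : Fin m → ZMod n) (e : Equiv.Perm (Fin m)) :
    tupleFourier ψ (altChain c) (s ∘ e) =
      (Equiv.Perm.sign e : ℤ) * tupleFourier ψ (altChain c) s := by
  rw [tupleFourier, ← Equiv.sum_comp (e.symm.arrowCongr (Equiv.refl (ZMod n))), tupleFourier,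
    Finset.mul_sum]
  refine Finset.sum_congr rfl fun x _ => ?_
  have hx : e.symm.arrowCongr (Equiv.refl (ZMod n)) x = x ∘ e := rfl
  rw [hx, altChain_comp_perm, mul_assoc, ← Equiv.sum_comp e fun i => s i * x i]
  rfl

theorem tupleFourier_altChain_eq_zero_of_not_injective [CharZero K] {s : Fin m → ZMod n}
    (hs : ¬ Function.Injective s) : tupleFourier ψ (altChain c) s = 0 := by
  simp only [Function.Injective, not_forall] at hs
  obtain ⟨i, j, hij, hne⟩ := hs
  have h := tupleFourier_altChain_comp_perm ψ c s (Equiv.swap i j)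
  have hswap : s ∘ Equiv.swap i j = s := by
    funext a
    simp only [Function.comp_apply, Equiv.swap_apply_def]
    split_ifs with hai haj <;> simp [*]
  rw [hswap, Equiv.Perm.sign_swap hne] at h
  simpa [self_eq_neg] using h

variable {c}

theorem tupleFourier_altChain_eq_zero_of_zero_mem (hc : bdry n K c = 0) {s : Fin (m + 1) → ZMod n}
    {i : Fin (m + 1)} (hi : s i = 0) : tupleFourier ψ (altChain c) s = 0 := by
  have hzero {s : Fin (m + 1) → ZMod n} (hs : s 0 = 0) : tupleFourier ψ (altChain c) s = 0 := by
    rw [tupleFourier, ← Equiv.sum_comp (Fin.consEquiv fun _ => ZMod n), Fintype.sum_prod_type_right]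
    refine Finset.sum_eq_zero fun y _ => ?_
    simp only [Fin.consEquiv_apply, Fin.sum_univ_succ, Fin.cons_zero, Fin.cons_succ, hs, zero_mul,
      zero_add, ← Finset.sum_mul]
    exact mul_eq_zero_of_left ((sum_altChain_cons c y).trans (by simp [hc])) _
  have h := hzero (s := s ∘ Equiv.swap 0 i) (by simpa using hi)
  rw [tupleFourier_altChain_comp_perm] at h
  refine (mul_eq_zero.mp h).resolve_left ?_
  rcases Int.units_eq_one_or (Equiv.Perm.sign (Equiv.swap 0 i)) with he | he <;> simp [he]

/-- Translating the frequency by a constant `t` gives a function of `t` whose Fourier transform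
is supported on the sums of the tuples in the support of the chain. -/
theorem tupleFourier_altChain_add_const {A : Finset (ZMod n)}
    (hc : ∀ σ, c σ ≠ 0 → ∑ x ∈ σ, x ∈ A) (s : Fin m → ZMod n) (t : ZMod n) :
    tupleFourier ψ (altChain c) (fun i => s i + t) =
      ∑ a ∈ A, (∑ x : Fin m → ZMod n with ∑ i, x i = a, altChain c x * ψ (∑ i, s i * x i)) *
        ψ (t * a) := by
  have hsupp (x : Fin m → ZMod n) (hx : ∑ i, x i ∉ A) : altChain c x = 0 := by
    by_contra hne
    obtain ⟨hsign, hcx⟩ := mul_ne_zero_iff.mp hne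
    have hinj := tupleSign_ne_zero_iff.mp fun h => hsign (by rw [h, Int.cast_zero])
    have := hc _ hcx
    rw [Finset.sum_image hinj.injOn] at this
    exact hx this
  have hterm (x : Fin m → ZMod n) : ψ (∑ i, (s i + t) * x i) =
      ψ (∑ i, s i * x i) * ψ (t * ∑ i, x i) := by
    rw [← AddChar.map_add_eq_mul, Finset.mul_sum, ← Finset.sum_add_distrib]
    simp only [add_mul]
  simp only [tupleFourier, hterm, Finset.sum_mul]
  have hinner (a : ZMod n) : ∑ x : Fin m → ZMod n with ∑ i, x i = a,
      altChain c x * ψ (∑ i, s i * x i) * ψ (t * a) =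
      ∑ x : Fin m → ZMod n with ∑ i, x i = a,
        altChain c x * ψ (∑ i, s i * x i) * ψ (t * ∑ i, x i) :=
    Finset.sum_congr rfl fun x hx => by rw [(Finset.mem_filter.mp hx).2]
  simp only [hinner, ← mul_assoc]
  rw [← Finset.sum_subset (Finset.filter_subset (fun x : Fin m → ZMod n => ∑ i, x i ∈ A) _)]
  · rw [← Finset.sum_fiberwise_of_maps_to (g := fun x : Fin m → ZMod n => ∑ i, x i) (t := A)
      fun x hx => (Finset.mem_filter.mp hx).2]
    refine Finset.sum_congr rfl fun a ha => ?_
    congr 1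
    ext x
    simp only [Finset.mem_filter, Finset.mem_univ, true_and]
    exact ⟨fun h => h.2, fun h => ⟨h ▸ ha, h⟩⟩
  · intro x _ hx
    rw [hsupp x (by simpa using hx), zero_mul, zero_mul]

end Fourier

section Cycles

variable {n : ℕ} [NeZero n] {k : ℕ} {A : Finset (ZMod n)}

theorem tupleFourier_altChain_eq_zero {K : Type*} [Field K] [NumberField K]
    [IsCyclotomicExtension {n} ℚ K] (hn : n.Prime) {ζ : K} (hζ : IsPrimitiveRoot ζ n)
    (hA : A.card = k + 1) {c : Finset (ZMod n) → K} (hc : ∀ σ, c σ ≠ 0 → ∑ x ∈ σ, x ∈ A)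
    (hbdry : bdry n K c = 0) (s : Fin (k + 1) → ZMod n) :
    tupleFourier (AddChar.zmodChar n hζ.pow_eq_one) (altChain c) s = 0 := by
  by_cases hs : Function.Injective s
  swap
  · exact tupleFourier_altChain_eq_zero_of_not_injective _ _ hs
  have hcard : A.card = (Finset.univ.image fun i => -s i).card := by
    rw [Finset.card_image_of_injective _ fun i j h => hs (neg_injective h), hA, Finset.card_fin]
  have hzero := eq_zero_of_sum_mul_pow_eq_zero hn hζ hcard
    (fun a => ∑ x : Fin (k + 1) → ZMod n with ∑ i, x i = a,
      altChain c x * AddChar.zmodChar n hζ.pow_eq_one (∑ i, s i * x i)) (fun t ht => by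
    obtain ⟨i, -, rfl⟩ := Finset.mem_image.mp ht
    have h := tupleFourier_altChain_add_const (AddChar.zmodChar n hζ.pow_eq_one) hc s (-s i)
    rw [tupleFourier_altChain_eq_zero_of_zero_mem _ hbdry (i := i) (by simp)] at h
    rw [h]
    refine Finset.sum_congr rfl fun a _ => ?_
    rw [← AddChar.zmodChar_apply' hζ.pow_eq_one, Nat.cast_mul, ZMod.natCast_zmod_val,
      ZMod.natCast_zmod_val])
  have h := tupleFourier_altChain_add_const (AddChar.zmodChar n hζ.pow_eq_one) hc s 0
  rw [Finset.sum_eq_zero fun a ha => by rw [hzero a ha, zero_mul]] at h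
  simpa using h

theorem eq_zero_of_bdry_eq_zero (hn : n.Prime) (hA : A.card = k + 1) {c : Finset (ZMod n) → ℚ}
    (hc : ∀ σ, σ ∉ sumComplexFacets n k A → c σ = 0) (hbdry : bdry n ℚ c = 0) : c = 0 := by
  have hfacet (σ : Finset (ZMod n)) (hσ : c σ ≠ 0) : σ.card = k + 1 ∧ ∑ x ∈ σ, x ∈ A := by
    simpa [sumComplexFacets] using not_imp_comm.mp (hc σ) hσ
  let K := CyclotomicField n ℚ
  have : CharZero K := algebraRat.charZero K
  have : IsCyclotomicExtension {n} ℚ K := CyclotomicField.isCyclotomicExtension n ℚ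
  have hζ := IsCyclotomicExtension.zeta_spec n ℚ K
  have hbdryK : bdry n K (fun σ => (c σ : K)) = 0 := by
    funext τ
    have h := congrArg (Rat.cast : ℚ → K) (congrFun hbdry τ)
    rw [bdry_apply_eq_sum] at h ⊢
    simpa using h
  have halt : altChain (m := k + 1) (fun σ => (c σ : K)) = 0 :=
    eq_zero_of_tupleFourier_eq_zero (AddChar.zmodChar_primitive_of_primitive_root n hζ)
      (tupleFourier_altChain_eq_zero hn hζ hA (fun σ hσ => (hfacet σ (by simpa using hσ)).2) hbdryK)
  funext σ
  by_contra hσ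
  have hcard := (hfacet σ hσ).1
  let x : Fin (k + 1) → ZMod n := fun i => (σ.equivFinOfCardEq hcard).symm i
  have hx : Function.Injective x :=
    Subtype.val_injective.comp (σ.equivFinOfCardEq hcard).symm.injective
  have himage : Finset.univ.image x = σ := by
    refine Finset.eq_of_subset_of_card_le (fun a ha => ?_) ?_
    · obtain ⟨i, -, rfl⟩ := Finset.mem_image.mp ha
      exact Subtype.coe_prop _
    · rw [Finset.card_image_of_injective _ hx, Finset.card_fin, hcard]
  have h := congrFun halt x
  rw [altChain, himage] at h
  rcases mul_eq_zero.mp h with h | h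
  · exact tupleSign_ne_zero_iff.mpr hx (by exact_mod_cast h)
  · exact hσ (by exact_mod_cast h)

theorem linearIndependent_bdry_ind (hn : n.Prime) (hA : A.card = k + 1) :
    LinearIndependent ℚ
      (fun σ : {σ // σ ∈ sumComplexFacets n k A} => bdry n ℚ (ind n ℚ σ.1)) := by
  rw [Fintype.linearIndependent_iff]
  intro g hg σ
  simp only [← map_smul, ← map_sum] at hg
  have happly (τ : Finset (ZMod n)) :
      (∑ σ : {σ // σ ∈ sumComplexFacets n k A}, g σ • ind n ℚ σ.1) τ =
        if h : τ ∈ sumComplexFacets n k A then g ⟨τ, h⟩ else 0 := by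
    simp only [Finset.sum_apply, Pi.smul_apply, ind, smul_eq_mul, mul_ite, mul_one, mul_zero]
    split_ifs with h
    · rw [Finset.sum_eq_single ⟨τ, h⟩]
      · simp
      · exact fun σ _ hσ => if_neg fun hτ => hσ (Subtype.ext hτ.symm)
      · simp
    · exact Finset.sum_eq_zero fun σ _ => if_neg fun hτ : τ = σ.1 => h (hτ ▸ σ.2)
  have h := congrFun (eq_zero_of_bdry_eq_zero hn hA (fun τ hτ => by rw [happly, dif_neg hτ]) hg) σ.1
  rwa [happly, dif_pos σ.2] at h

theorem hTop_eq_zero (hn : n.Prime) (hA : A.card = k + 1) : hTop n ℚ k A = 0 := by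
  rw [hTop, Submodule.finrank_eq_zero, LinearMap.ker_eq_bot']
  rintro ⟨c, hc⟩ hbdry
  refine Subtype.ext (eq_zero_of_bdry_eq_zero hn hA (fun σ hσ => ?_) hbdry)
  have hle : Submodule.span ℚ (ind n ℚ '' ↑(sumComplexFacets n k A)) ≤
      LinearMap.ker (LinearMap.proj (R := ℚ) (φ := fun _ : Finset (ZMod n) => ℚ) σ) := by
    rw [Submodule.span_le]
    rintro _ ⟨τ, hτ, rfl⟩
    exact if_neg fun h : σ = τ => hσ (h ▸ hτ)
  exact hle hc

end Cycles

section Counting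

variable {n : ℕ} [NeZero n] {k : ℕ}

theorem card_filter_sum_eq (hn : n.Prime) (hkn : k + 1 < n) (a : ZMod n) :
    ((Finset.univ : Finset (Finset (ZMod n))).filter
      fun σ => σ.card = k + 1 ∧ ∑ x ∈ σ, x = a).card =
    ((Finset.univ : Finset (Finset (ZMod n))).filter
      fun σ => σ.card = k + 1 ∧ ∑ x ∈ σ, x = 0).card := by
  have : Fact n.Prime := ⟨hn⟩
  have hk : ((k + 1 : ℕ) : ZMod n) ≠ 0 := by
    rw [Ne, ZMod.natCast_eq_zero_iff]
    exact Nat.not_dvd_of_pos_of_lt k.succ_pos hkn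
  obtain ⟨t, ht⟩ : ∃ t : ZMod n, ((k + 1 : ℕ) : ZMod n) * t = -a := ⟨_, mul_div_cancel₀ (-a) hk⟩
  refine Finset.card_equiv (Equiv.finsetCongr (Equiv.addRight t)) fun σ => ?_
  simp only [Finset.mem_filter, Finset.mem_univ, true_and, Equiv.finsetCongr_apply,
    Finset.card_map, Finset.sum_map, Equiv.coe_toEmbedding, Equiv.coe_addRight,
    Finset.sum_add_distrib, Finset.sum_const, nsmul_eq_mul]
  refine and_congr_right fun hσ => ?_
  rw [hσ, ht, add_neg_eq_zero]

theorem card_sumComplexFacets (hn : n.Prime) (hkn : k + 1 < n) {A : Finset (ZMod n)}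
    (hA : A.card = k + 1) : (sumComplexFacets n k A).card = (n - 1).choose k := by
  set N := ((Finset.univ : Finset (Finset (ZMod n))).filter
    fun σ => σ.card = k + 1 ∧ ∑ x ∈ σ, x = 0).card with hN
  have hfacets (B : Finset (ZMod n)) : (sumComplexFacets n k B).card = B.card * N := by
    rw [Finset.card_eq_sum_card_fiberwise (f := fun σ => ∑ x ∈ σ, x) (t := B)
      fun σ hσ => (Finset.mem_filter.mp hσ).2.2, ← smul_eq_mul, ← Finset.sum_const]
    refine Finset.sum_congr rfl fun b hb => ?_
    rw [hN, ← card_filter_sum_eq hn hkn b, sumComplexFacets, Finset.filter_filter]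
    congr 1
    ext σ
    simp only [Finset.mem_filter, Finset.mem_univ, true_and]
    exact ⟨fun h => ⟨h.1.1, h.2⟩, fun h => ⟨⟨h.1, h.2 ▸ hb⟩, h.2⟩⟩
  have htotal : n * N = n.choose (k + 1) := by
    have h := hfacets Finset.univ
    rw [Finset.card_univ, ZMod.card] at h
    have hpow : sumComplexFacets n k Finset.univ = Finset.powersetCard (k + 1) Finset.univ := by
      ext σ
      simp [sumComplexFacets, Finset.mem_powersetCard]
    rw [← h, hpow, Finset.card_powersetCard, Finset.card_univ, ZMod.card]
  have hchoose := Nat.add_one_mul_choose_eq (n - 1) k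
  rw [Nat.sub_add_cancel hn.one_le, ← htotal] at hchoose
  rw [hfacets, hA]
  refine Nat.eq_of_mul_eq_mul_left hn.pos ?_
  rw [hchoose]
  ring

end Counting

/-- For `n` prime, `k+1 < n` and `|A| = k+1`, the boundaries of the facets
of the sum complex `X_A` are linearly independent over `ℚ`; consequently `h_k(X_A;ℚ) = 0`
and `X_A` has `C(n-1,k)` facets, so `X_A` is a `k`-hypertree. -/
theorem sum_complex_is_hypertree (n k : ℕ) [NeZero n] (hn : n.Prime) (hk : 0 < k)
    (hkn : k + 1 < n) (A : Finset (ZMod n)) (hA : A.card = k + 1) :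
    LinearIndependent ℚ
      (fun σ : {σ // σ ∈ sumComplexFacets n k A} => bdry n ℚ (ind n ℚ σ.1)) ∧
    hTop n ℚ k A = 0 ∧
    (sumComplexFacets n k A).card = Nat.choose (n - 1) k :=
  ⟨linearIndependent_bdry_ind hn hA, hTop_eq_zero hn hA, card_sumComplexFacets hn hkn hA⟩
end

section
/- Let n be a prime, let k be a positive integer with k+1 < n, and let A ⊆ ℤ_n with |A| = k+1. If A is an arithmetic progression in ℤ_n, then the sum complex X_A is k-collapsible. -/
open scoped BigOperators

/-- The sum complex `X_A` as a finite family of finite subsets of `ℤ_n`, closed under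
taking subsets: all subsets of size at most `k`, together with the facets, namely the
`(k+1)`-element subsets whose element-sum lies in `A`. -/
def sumComplex (n k : ℕ) [NeZero n] (A : Finset (ZMod n)) : Finset (Finset (ZMod n)) :=
  Finset.univ.filter (fun σ => σ.card ≤ k ∨ (σ.card = k + 1 ∧ (∑ x ∈ σ, x) ∈ A))

/-- `τ` is a maximal face of the complex `X`. -/
def IsMaxFace {V : Type*} [DecidableEq V] (X : Finset (Finset V)) (τ : Finset V) : Prop :=
  τ ∈ X ∧ ∀ ρ ∈ X, τ ⊆ ρ → ρ = τ

/-- An elementary `k`-collapse: `σ` is a face of `X` of cardinality at most `k` contained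
in a unique maximal face `τ` of `X`, and `Y = X ∖ [σ, τ]` where
`[σ,τ] = {η : σ ⊆ η ⊆ τ}`. -/
def ElemCollapse {V : Type*} [DecidableEq V] (k : ℕ) (X Y : Finset (Finset V)) : Prop :=
  ∃ σ τ : Finset V, σ ∈ X ∧ σ.card ≤ k ∧ σ ⊆ τ ∧ IsMaxFace X τ ∧
    (∀ ρ : Finset V, IsMaxFace X ρ → σ ⊆ ρ → ρ = τ) ∧
    Y = X.filter (fun η => ¬ (σ ⊆ η ∧ η ⊆ τ))

/-- `X` is `k`-collapsible: some finite sequence of elementary `k`-collapses reduces `X`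
to the complex `{∅}`. -/
def Collapsible {V : Type*} [DecidableEq V] (k : ℕ) (X : Finset (Finset V)) : Prop :=
  Relation.ReflTransGen (ElemCollapse k) X {∅}

/-- `A ⊆ ℤ_n` is an arithmetic progression. -/
def IsAP (n : ℕ) (A : Finset (ZMod n)) : Prop :=
  ∃ a d : ZMod n, A = (Finset.range A.card).image (fun i : ℕ => a + (i : ZMod n) * d)

namespace SumComplex

section Nth

variable {G : Finset ℕ} {i j : ℕ}

lemma lt_card_toFinset_ofPred (hi : i < G.card) (hf : (Set.ofPred (· ∈ G)).Finite) :
    i < hf.toFinset.card := by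
  have : hf.toFinset = G := by ext; simp
  rwa [this]

lemma nth_mem_finset (hi : i < G.card) : Nat.nth (· ∈ G) i ∈ G :=
  Nat.nth_mem (p := (· ∈ G)) i (lt_card_toFinset_ofPred hi)

lemma card_filter_lt_nth (hi : i < G.card) :
    (G.filter (· < Nat.nth (· ∈ G) i)).card = i := by
  have h := Nat.count_nth (p := (· ∈ G)) (lt_card_toFinset_ofPred hi)
  rw [Nat.count_eq_card_filter_range] at h
  conv_rhs => rw [← h]
  congr 1
  ext
  simp [and_comm]

lemma nth_add_sub_le (hij : i ≤ j) (hj : j < G.card) :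
    Nat.nth (· ∈ G) i + (j - i) ≤ Nat.nth (· ∈ G) j := by
  induction j, hij using Nat.le_induction with
  | base => simp
  | succ j hij ih =>
    have h1 := ih (by omega)
    have h2 : Nat.nth (· ∈ G) j < Nat.nth (· ∈ G) (j + 1) :=
      Nat.nth_lt_nth' (Nat.lt_succ_self j) (lt_card_toFinset_ofPred hj)
    omega

/-- Replacing an element `x` by an element `y` at least as large as the `i`-th smallest element
of `G` does not decrease the `i`-th smallest element. -/
lemma nth_le_nth_of_erase_subset {G' : Finset ℕ} {x y : ℕ} (hi : i < G.card)
    (hi' : i < G'.card) (hG' : G' = insert y (G.erase x))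
    (hy : Nat.nth (· ∈ G) i ≤ y) : Nat.nth (· ∈ G) i ≤ Nat.nth (· ∈ G') i := by
  by_contra! hlt
  have hsub : insert (Nat.nth (· ∈ G') i) (G'.filter (· < Nat.nth (· ∈ G') i)) ⊆
      G.filter (· < Nat.nth (· ∈ G) i) := by
    have key : ∀ z ∈ G', z < Nat.nth (· ∈ G) i → z ∈ G := by
      intro z hz hzlt
      rw [hG'] at hz
      rcases Finset.mem_insert.1 hz with rfl | hz
      · omega
      · exact Finset.mem_of_mem_erase hz
    intro z hz
    rcases Finset.mem_insert.1 hz with rfl | hz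
    · exact Finset.mem_filter.2 ⟨key _ (nth_mem_finset hi') hlt, hlt⟩
    · obtain ⟨hz1, hz2⟩ := Finset.mem_filter.1 hz
      exact Finset.mem_filter.2 ⟨key _ hz1 (hz2.trans hlt), hz2.trans hlt⟩
  have hcard := Finset.card_le_card hsub
  rw [Finset.card_insert_of_notMem (by simp), card_filter_lt_nth hi,
    card_filter_lt_nth hi'] at hcard
  omega

end Nth

/-- If `G'` arises from `G` by replacing the element of index `(∑ G) % n`, then for every
`m ≤ (∑ G) % n, (∑ G') % n` the `m`-th smallest element does not decrease; it strictly increases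
if `m = (∑ G) % n`. -/
lemma nth_le_nth_of_exchange {n k m : ℕ} {G G' : Finset ℕ} (hG : G.card = k + 1)
    (hG' : G'.card = k + 1) (hGn : ∀ x ∈ G, x < n) (hGn' : ∀ x ∈ G', x < n)
    (hs : (∑ x ∈ G, x) % n ≤ k) (hs' : (∑ x ∈ G', x) % n ≤ k)
    (hm : m ≤ (∑ x ∈ G, x) % n) (hm' : m ≤ (∑ x ∈ G', x) % n)
    (hsub : G.erase (Nat.nth (· ∈ G) ((∑ x ∈ G, x) % n)) ⊆ G') (hne : G' ≠ G) :
    Nat.nth (· ∈ G) m ≤ Nat.nth (· ∈ G') m ∧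
      (m = (∑ x ∈ G, x) % n → Nat.nth (· ∈ G) m ≠ Nat.nth (· ∈ G') m) := by
  set t := (∑ x ∈ G, x) % n with ht
  set t' := (∑ x ∈ G', x) % n with ht'
  set x := Nat.nth (· ∈ G) t with hx
  have hxG : x ∈ G := nth_mem_finset (by omega)
  have hec : (G.erase x).card = k := by rw [Finset.card_erase_of_mem hxG]; omega
  obtain ⟨y, hy, hG'eq⟩ : ∃ y ∉ G.erase x, insert y (G.erase x) = G' := by
    have h1 : (G' \ G.erase x).card = 1 := by rw [Finset.card_sdiff_of_subset hsub]; omega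
    obtain ⟨y, hy⟩ := Finset.card_eq_one.1 h1
    have hyy : y ∈ G' \ G.erase x := by simp [hy]
    refine ⟨y, (Finset.mem_sdiff.1 hyy).2, ?_⟩
    rw [Finset.insert_eq, ← hy, Finset.sdiff_union_of_subset hsub]
  have hyx : y ≠ x := by
    rintro rfl
    exact hne (by rw [← hG'eq, Finset.insert_erase hxG])
  have hyG : y ∉ G := fun h => hy (Finset.mem_erase.2 ⟨hyx, h⟩)
  have hsum : (∑ z ∈ G', z) + x = (∑ z ∈ G, z) + y := by
    rw [← hG'eq, Finset.sum_insert hy, ← Finset.sum_erase_add G _ hxG]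
    ring
  have hyn : y < n := hGn' y (by simp [← hG'eq])
  have hxk : x + (k - t) ≤ Nat.nth (· ∈ G) k := nth_add_sub_le hs (by omega)
  have hkn : Nat.nth (· ∈ G) k < n := hGn _ (nth_mem_finset (by omega))
  have hmx : Nat.nth (· ∈ G) m + (t - m) ≤ x := nth_add_sub_le hm (by omega)
  have h0x : Nat.nth (· ∈ G) 0 + (t - 0) ≤ x := nth_add_sub_le (Nat.zero_le t) (by omega)
  have hyeq : y = x + t' - t := by
    have hmod : y + t ≡ x + t' [MOD n] := by
      have h1 : ∑ z ∈ G, z ≡ t [MOD n] := (Nat.mod_modEq _ _).symm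
      have h2 : ∑ z ∈ G', z ≡ t' [MOD n] := (Nat.mod_modEq _ _).symm
      calc y + t ≡ y + ∑ z ∈ G, z [MOD n] := (h1.symm.add_left y)
        _ = x + ∑ z ∈ G', z := by omega
        _ ≡ x + t' [MOD n] := h2.add_left x
    have hmod' : y + t ≡ (x + t' - t) + t [MOD n] := by
      rwa [Nat.sub_add_cancel (by omega)]
    exact (Nat.ModEq.add_right_cancel' t hmod').eq_of_lt_of_lt hyn (by omega)
  refine ⟨nth_le_nth_of_erase_subset (by omega) (by omega) hG'eq.symm (by omega), ?_⟩
  intro hmt heq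
  have hxG' : x ∈ G' := by
    rw [hx, ← hmt, heq]
    exact nth_mem_finset (by omega)
  rw [← hG'eq] at hxG'
  rcases Finset.mem_insert.1 hxG' with h | h
  · exact hyx h.symm
  · exact Finset.notMem_erase x G h

/-- A nonempty family of `(k+1)`-subsets of `{0, …, n-1}` with sums in `{0, …, k}` modulo `n`
has a member containing a `k`-subset that lies in no other member. -/
lemma exists_erase_subset_unique {n k : ℕ} {S : Finset (Finset ℕ)} (hS : S.Nonempty)
    (hcard : ∀ G ∈ S, G.card = k + 1) (hlt : ∀ G ∈ S, ∀ x ∈ G, x < n)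
    (hsum : ∀ G ∈ S, (∑ x ∈ G, x) % n ≤ k) :
    ∃ G ∈ S, ∃ x ∈ G, ∀ G' ∈ S, G.erase x ⊆ G' → G' = G := by
  by_contra! hcon
  have hstep : ∀ m, ∃ T ⊆ S, T.Nonempty ∧ (∀ G ∈ T, m ≤ (∑ x ∈ G, x) % n) ∧
      ∀ G ∈ T, ∃ G' ∈ T, G.erase (Nat.nth (· ∈ G) ((∑ x ∈ G, x) % n)) ⊆ G' ∧ G' ≠ G := by
    intro m
    induction m with
    | zero =>
      refine ⟨S, subset_rfl, hS, by simp, fun G hG => hcon G hG _ (nth_mem_finset ?_)⟩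
      have := hcard G hG
      have := hsum G hG
      omega
    | succ m ih =>
      obtain ⟨T, hTS, hTne, hTm, hT⟩ := ih
      obtain ⟨M, hM, hMmax⟩ := T.exists_max_image (fun G => Nat.nth (· ∈ G) m) hTne
      have hclosed : ∀ G ∈ T, Nat.nth (· ∈ G) m = Nat.nth (· ∈ M) m →
          ∃ G' ∈ T, Nat.nth (· ∈ G') m = Nat.nth (· ∈ M) m ∧ m ≠ (∑ x ∈ G, x) % n ∧
            G.erase (Nat.nth (· ∈ G) ((∑ x ∈ G, x) % n)) ⊆ G' ∧ G' ≠ G := by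
        intro G hG hGM
        obtain ⟨G', hG', hsub, hne⟩ := hT G hG
        obtain ⟨hle, hstrict⟩ := nth_le_nth_of_exchange (hcard G (hTS hG)) (hcard G' (hTS hG'))
          (hlt G (hTS hG)) (hlt G' (hTS hG')) (hsum G (hTS hG)) (hsum G' (hTS hG'))
          (hTm G hG) (hTm G' hG') hsub hne
        have heq : Nat.nth (· ∈ G') m = Nat.nth (· ∈ M) m :=
          le_antisymm (hMmax G' hG') (hGM ▸ hle)
        exact ⟨G', hG', heq, fun hm => hstrict hm (hGM.trans heq.symm), hsub, hne⟩
      refine ⟨T.filter fun G => Nat.nth (· ∈ G) m = Nat.nth (· ∈ M) m,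
        (Finset.filter_subset _ _).trans hTS, ⟨M, Finset.mem_filter.2 ⟨hM, rfl⟩⟩, ?_, ?_⟩
      · intro G hG
        obtain ⟨hG, hGM⟩ := Finset.mem_filter.1 hG
        obtain ⟨-, -, -, hm, -⟩ := hclosed G hG hGM
        exact lt_of_le_of_ne (hTm G hG) hm
      · intro G hG
        obtain ⟨hG, hGM⟩ := Finset.mem_filter.1 hG
        obtain ⟨G', hG', heq, -, hsub, hne⟩ := hclosed G hG hGM
        exact ⟨G', Finset.mem_filter.2 ⟨hG', heq⟩, hsub, hne⟩
  obtain ⟨T, hTS, ⟨G, hG⟩, hTm, -⟩ := hstep (k + 1)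
  have := hTm G hG
  have := hsum G (hTS hG)
  omega

/-- A complex of dimension at most `k` is `k`-collapsible if every nonempty family of its
`k`-dimensional faces has a member with a `k`-subset lying in no other member. -/
lemma collapsible_of_forall_exists_unique {V : Type*} [DecidableEq V] {k : ℕ} (hk : 0 < k)
    (X : Finset (Finset V)) (hempty : ∅ ∈ X) (hdim : ∀ σ ∈ X, σ.card ≤ k + 1)
    (hridge : ∀ F ∈ X, F.card = k + 1 → ∀ σ ⊆ F, σ.card = k → σ ∈ X)
    (hfree : ∀ S ⊆ X, S.Nonempty → (∀ F ∈ S, F.card = k + 1) →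
      ∃ F ∈ S, ∃ σ ⊆ F, σ.card = k ∧ ∀ F' ∈ S, σ ⊆ F' → F' = F) :
    Collapsible k X := by
  induction hN : X.card using Nat.strong_induction_on generalizing X with
  | _ N ih =>
  subst hN
  have hcollapse : ∀ Y, ElemCollapse k X Y → Y ⊆ X → Y.card < X.card → ∅ ∈ Y →
      (∀ F ∈ Y, F.card = k + 1 → ∀ σ ⊆ F, σ.card = k → σ ∈ Y) → Collapsible k X := by
    intro Y hXY hYX hlt hYe hYr
    exact (ih _ hlt Y hYe (fun σ hσ => hdim σ (hYX hσ)) hYr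
      (fun S hS => hfree S (hS.trans hYX)) rfl).head hXY
  by_cases hfac : (X.filter fun F => F.card = k + 1).Nonempty
  · obtain ⟨F, hF, σ, hσF, hσk, huniq⟩ := hfree _ (Finset.filter_subset _ _) hfac
      (fun F hF => (Finset.mem_filter.1 hF).2)
    obtain ⟨hFX, hFk⟩ := Finset.mem_filter.1 hF
    have hσX := hridge F hFX hFk σ hσF hσk
    refine hcollapse (X.filter fun η => ¬ (σ ⊆ η ∧ η ⊆ F))
      ⟨σ, F, hσX, hσk.le, hσF, ⟨hFX, ?_⟩, ?_, rfl⟩ (Finset.filter_subset _ _) ?_ ?_ ?_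
    · intro ρ hρ hFρ
      exact (Finset.eq_of_subset_of_card_le hFρ (by rw [hFk]; exact hdim ρ hρ)).symm
    · intro ρ hρ hσρ
      refine huniq ρ (Finset.mem_filter.2 ⟨hρ.1, ?_⟩) hσρ
      by_contra hne
      have h1 := hdim ρ hρ.1
      have : σ = ρ := Finset.eq_of_subset_of_card_le hσρ (by omega)
      subst this
      have := hρ.2 F hFX hσF
      subst this
      omega
    · exact Finset.card_lt_card (Finset.filter_ssubset.2 ⟨σ, hσX, by simp [hσF]⟩)
    · refine Finset.mem_filter.2 ⟨hempty, fun h => ?_⟩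
      have := Finset.subset_empty.1 h.1
      subst this
      simp at hσk
      omega
    · intro F' hF' hF'k ρ hρ hρk
      obtain ⟨hF'X, hnot⟩ := Finset.mem_filter.1 hF'
      refine Finset.mem_filter.2 ⟨hridge F' hF'X hF'k ρ hρ hρk, fun h => hnot ?_⟩
      have := huniq F' (Finset.mem_filter.2 ⟨hF'X, hF'k⟩) (h.1.trans hρ)
      subst this
      exact ⟨hσF, subset_rfl⟩
  · have hcard : ∀ F ∈ X, F.card ≤ k := by
      intro F hF
      have h1 := hdim F hF
      have h2 : F.card ≠ k + 1 := fun h => hfac ⟨F, Finset.mem_filter.2 ⟨hF, h⟩⟩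
      omega
    by_cases hX : X = {∅}
    · rw [hX]
      exact Relation.ReflTransGen.refl
    obtain ⟨F, hF, hmax⟩ := X.exists_max_image Finset.card ⟨∅, hempty⟩
    have hFne : F ≠ ∅ := by
      rintro rfl
      refine hX (Finset.eq_singleton_iff_unique_mem.2 ⟨hempty, fun ρ hρ => ?_⟩)
      simpa using hmax ρ hρ
    have hFmax : ∀ ρ ∈ X, F ⊆ ρ → ρ = F := fun ρ hρ h =>
      (Finset.eq_of_subset_of_card_le h (hmax ρ hρ)).symm
    refine hcollapse (X.filter fun η => ¬ (F ⊆ η ∧ η ⊆ F))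
      ⟨F, F, hF, hcard F hF, subset_rfl, ⟨hF, hFmax⟩, fun ρ hρ => hFmax ρ hρ.1, rfl⟩
      (Finset.filter_subset _ _) ?_ ?_ ?_
    · exact Finset.card_lt_card (Finset.filter_ssubset.2 ⟨F, hF, by simp⟩)
    · exact Finset.mem_filter.2 ⟨hempty, fun h => hFne (Finset.subset_empty.1 h.1)⟩
    · intro F' hF' hF'k
      have := hcard F' (Finset.mem_filter.1 hF').1
      omega

end SumComplex

/-- For `n` prime, `k+1 < n`, `|A| = k+1`: if `A` is an arithmetic
progression in `ℤ_n`, then the sum complex `X_A` is `k`-collapsible. -/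
theorem sum_complex_collapsible_of_AP (n k : ℕ) [NeZero n] (hn : n.Prime) (hk : 0 < k)
    (hkn : k + 1 < n) (A : Finset (ZMod n)) (hA : A.card = k + 1) (hAP : IsAP n A) :
    Collapsible k (sumComplex n k A) := by
  classical
  have : Fact n.Prime := ⟨hn⟩
  obtain ⟨a, d, hAd⟩ := hAP
  rw [hA] at hAd
  have hd : d ≠ 0 := by
    rintro rfl
    have : A.card ≤ 1 := by
      rw [hAd]
      exact Finset.card_le_one.2 (by simp)
    omega
  have hk1 : ((k + 1 : ℕ) : ZMod n) ≠ 0 := by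
    rw [Ne, ZMod.natCast_eq_zero_iff]
    exact fun h => absurd (Nat.le_of_dvd (Nat.succ_pos k) h) (by omega)
  -- The affine change of coordinates taking the sums in `A` to `{0, …, k}`.
  set b : ZMod n := a / ((k + 1 : ℕ) : ZMod n) with hb
  set g : ZMod n → ℕ := fun x => ((x - b) / d).val with hg
  have hginj : Function.Injective g := by
    intro x y hxy
    have := ZMod.val_injective n hxy
    rwa [div_left_inj' hd, sub_left_inj] at this
  have hgcast : ∀ x, ((g x : ℕ) : ZMod n) = (x - b) / d := fun x => ZMod.natCast_zmod_val _
  have hgsum : ∀ F : Finset (ZMod n), F.card = k + 1 → (∑ x ∈ F, x) ∈ A →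
      (∑ x ∈ F.image g, x) % n ≤ k := by
    intro F hF hFA
    rw [hAd] at hFA
    obtain ⟨i, hi, hiF⟩ := Finset.mem_image.1 hFA
    have hik := Finset.mem_range.1 hi
    have hcast : ((∑ x ∈ F.image g, x : ℕ) : ZMod n) = (i : ℕ) := by
      rw [Finset.sum_image hginj.injOn, Nat.cast_sum, Finset.sum_congr rfl fun x _ => hgcast x,
        ← Finset.sum_div, Finset.sum_sub_distrib, Finset.sum_const, hF, nsmul_eq_mul, hb,
        mul_div_cancel₀ _ hk1, ← hiF, add_sub_cancel_left, mul_div_cancel_right₀ _ hd]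
    have hmod : (∑ x ∈ F.image g, x) % n = i % n := (ZMod.natCast_eq_natCast_iff' _ _ _).1 hcast
    rw [hmod, Nat.mod_eq_of_lt (by omega)]
    omega
  have hmem : ∀ σ : Finset (ZMod n), σ ∈ sumComplex n k A ↔
      σ.card ≤ k ∨ (σ.card = k + 1 ∧ (∑ x ∈ σ, x) ∈ A) := by
    simp [sumComplex]
  refine SumComplex.collapsible_of_forall_exists_unique hk _ ?_ ?_ ?_ ?_
  · simp [hmem]
  · intro σ hσ
    rcases (hmem σ).1 hσ with h | h <;> omega
  · intro F _ _ σ _ hσ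
    exact (hmem σ).2 (Or.inl hσ.le)
  · intro S hSX hS hcard
    have himg : ∀ {P : Finset ℕ → Prop}, (∀ F ∈ S, P (F.image g)) →
        ∀ G ∈ S.image (Finset.image g), P G := by
      intro P h
      simpa using h
    obtain ⟨G, hG, x, hx, huniq⟩ := SumComplex.exists_erase_subset_unique (n := n) (k := k)
      (hS.image (Finset.image g))
      (himg fun F hF => by rw [Finset.card_image_of_injective _ hginj, hcard F hF])
      (himg fun F _ x hx => by
        obtain ⟨y, -, rfl⟩ := Finset.mem_image.1 hx
        exact ZMod.val_lt _)
      (himg fun F hF => by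
        refine hgsum F (hcard F hF) ?_
        rcases (hmem F).1 (hSX hF) with h | h
        · have := hcard F hF
          omega
        · exact h.2)
    obtain ⟨F, hF, rfl⟩ := Finset.mem_image.1 hG
    obtain ⟨y, hy, rfl⟩ := Finset.mem_image.1 hx
    refine ⟨F, hF, F.erase y, Finset.erase_subset _ _, ?_, fun F' hF' hsub => ?_⟩
    · rw [Finset.card_erase_of_mem hy, hcard F hF, Nat.add_sub_cancel]
    · refine Finset.image_injective hginj (huniq _ (Finset.mem_image_of_mem _ hF') ?_)
      rw [← Finset.image_erase hginj]
      exact Finset.image_subset_image hsub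
end

section
/- Let n, k be positive integers with k+1 coprime to n, let A ⊆ ℤ_n with |A| = k+1, and let F be a field whose characteristic does not divide n and which contains a primitive n-th root of unity ω. Then the image of the coboundary space B^{k−1}(X_A;F) under the Fourier transform equals the space of all alternating functions g : ℤ_n^k → F such that g(u_1,…,u_k) = 0 whenever all the coordinates u_1,…,u_k are nonzero; both spaces have dimension C(n−1, k−1) over F. -/
open scoped BigOperators

/-- `e(x) = ω^x` for `x ∈ ℤ_n`. -/
noncomputable def eF (n : ℕ) [NeZero n] (F : Type*) [Field F] (ω : F) (x : ZMod n) : F :=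
  ω ^ x.val

/-- A function `φ : ℤ_n^k → F` is alternating: permuting the coordinates multiplies the
value by the sign of the permutation, and the value vanishes on tuples with a repeated
coordinate. -/
def IsAlt (n : ℕ) [NeZero n] (F : Type*) [Field F] (k : ℕ)
    (φ : (Fin k → ZMod n) → F) : Prop :=
  (∀ (π : Equiv.Perm (Fin k)) (v : Fin k → ZMod n),
      φ (v ∘ π) = (Equiv.Perm.sign π : ℤ) • φ v) ∧
  (∀ v : Fin k → ZMod n, ¬ Function.Injective v → φ v = 0)

/-- The Fourier transform of `φ : ℤ_n^k → F`:
`φ̂(u) = ∑_x φ(x) e(-∑_j u_j x_j)`. -/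
noncomputable def fourierT (n : ℕ) [NeZero n] (F : Type*) [Field F] (ω : F) (k : ℕ)
    (φ : (Fin k → ZMod n) → F) : (Fin k → ZMod n) → F :=
  fun u => ∑ x : Fin k → ZMod n, φ x * eF n F ω (-(∑ j, u j * x j))

/-- Deletion of the `i`-th coordinate of a `k`-tuple (0-indexed). -/
def delCoord (n : ℕ) {k : ℕ} (i : Fin k) (v : Fin k → ZMod n) : Fin (k - 1) → ZMod n :=
  fun j =>
    if h : (j : ℕ) < (i : ℕ) then v ⟨(j : ℕ), lt_trans h i.isLt⟩
    else v ⟨(j : ℕ) + 1, by have := j.isLt; omega⟩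

lemma sum_eF_mul (n : ℕ) [NeZero n] (F : Type*) [Field F] {ω : F}
    (hω : IsPrimitiveRoot ω n) (b : ZMod n) :
    ∑ a : ZMod n, eF n F ω (a * b) = if b = 0 then (n : F) else 0 := by
  have h := AddChar.sum_mulShift b (AddChar.zmodChar_primitive_of_primitive_root n hω)
  simpa [AddChar.zmodChar_apply, eF] using h

lemma eF_add (n : ℕ) [NeZero n] (F : Type*) [Field F] {ω : F} (hω : IsPrimitiveRoot ω n)
    (x y : ZMod n) : eF n F ω (x + y) = eF n F ω x * eF n F ω y := by
  have h := AddChar.map_add_eq_mul (AddChar.zmodChar n hω.pow_eq_one) x y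
  simpa [AddChar.zmodChar_apply, eF] using h

lemma eF_sum (n : ℕ) [NeZero n] (F : Type*) [Field F] {ω : F} (hω : IsPrimitiveRoot ω n)
    {ι : Type*} (s : Finset ι) (f : ι → ZMod n) :
    eF n F ω (∑ i ∈ s, f i) = ∏ i ∈ s, eF n F ω (f i) := by
  classical
  induction s using Finset.induction_on with
  | empty => simp [eF]
  | insert a s ha ih => rw [Finset.sum_insert ha, Finset.prod_insert ha, eF_add n F hω, ih]

lemma sum_eF_dot (n : ℕ) [NeZero n] (F : Type*) [Field F] {ω : F}
    (hω : IsPrimitiveRoot ω n) {m : ℕ} (b : Fin m → ZMod n) :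
    ∑ x : Fin m → ZMod n, eF n F ω (∑ j, x j * b j) = if b = 0 then (n : F) ^ m else 0 := by
  simp_rw [eF_sum n F hω]
  have h := Finset.prod_univ_sum (fun _ : Fin m => (Finset.univ : Finset (ZMod n)))
    (fun j a => eF n F ω (a * b j))
  rw [Fintype.piFinset_univ] at h
  rw [← h]
  simp_rw [sum_eF_mul n F hω]
  split_ifs with hb
  · simp [hb]
  · obtain ⟨j, hj⟩ := Function.ne_iff.mp hb
    exact Finset.prod_eq_zero (Finset.mem_univ j) (if_neg hj)

lemma fourierT_fourierT (n : ℕ) [NeZero n] (F : Type*) [Field F] {ω : F}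
    (hω : IsPrimitiveRoot ω n) {m : ℕ} (h : (Fin m → ZMod n) → F) (u : Fin m → ZMod n) :
    fourierT n F ω m (fourierT n F ω m h) u = (n : F) ^ m * h (-u) := by
  unfold fourierT
  simp_rw [Finset.sum_mul, mul_assoc, ← eF_add n F hω]
  rw [Finset.sum_comm]
  simp_rw [← Finset.mul_sum]
  have key : ∀ y : Fin m → ZMod n,
      ∑ x : Fin m → ZMod n, eF n F ω (-(∑ j, x j * y j) + -(∑ j, u j * x j)) =
        if y = -u then (n : F) ^ m else 0 := by
    intro y
    have := sum_eF_dot n F hω (-(y + u))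
    simp only [neg_eq_zero, add_eq_zero_iff_eq_neg] at this
    rw [← this]
    refine Finset.sum_congr rfl fun x _ => congrArg _ ?_
    rw [← neg_add, ← Finset.sum_add_distrib, ← Finset.sum_neg_distrib]
    refine Finset.sum_congr rfl fun j _ => ?_
    simp only [Pi.neg_apply, Pi.add_apply]
    ring
  simp_rw [key]
  simp [mul_comm]

lemma IsAlt.transform {n : ℕ} [NeZero n] {F : Type*} [Field F] (ω : F) {m : ℕ}
    {h : (Fin m → ZMod n) → F} (hh : IsAlt n F m h) : IsAlt n F m (fourierT n F ω m h) := by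
  constructor
  · intro π v
    unfold fourierT
    rw [Finset.smul_sum, ← Equiv.sum_comp (Equiv.arrowCongr π (Equiv.refl (ZMod n))).symm]
    refine Finset.sum_congr rfl fun x _ => ?_
    have hx : (Equiv.arrowCongr π (Equiv.refl (ZMod n))).symm x = x ∘ π := by
      ext j; simp [Equiv.arrowCongr]
    rw [hx, hh.1 π x, smul_mul_assoc]
    congr 4
    exact Equiv.sum_comp π (fun j => v j * x j)
  · intro v hv
    obtain ⟨a, b, hab, hne⟩ := Function.not_injective_iff.mp hv
    have hvs : v ∘ Equiv.swap a b = v := by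
      ext j
      simp only [Function.comp_apply, Equiv.swap_apply_def]
      split_ifs with h₁ h₂ <;> simp_all
    refine Finset.sum_involution (fun x _ => x ∘ Equiv.swap a b) ?_ ?_ ?_ ?_
    · intro x _
      have hdot : ∑ j, v j * (x ∘ Equiv.swap a b) j = ∑ j, v j * x j := by
        conv_lhs => rw [← hvs]
        exact Equiv.sum_comp (Equiv.swap a b) (fun j => v j * x j)
      simp only [hdot]
      rw [hh.1, Equiv.Perm.sign_swap hne]
      simp
    · intro x _ hx hxs
      refine hx ?_
      rw [hh.2 x, zero_mul]
      intro hinj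
      have := congrFun hxs a
      simp only [Function.comp_apply, Equiv.swap_apply_left] at this
      exact hne (hinj this).symm
    · simp
    · intro x _
      ext j
      simp

lemma IsAlt.smul_comp_neg {n : ℕ} [NeZero n] {F : Type*} [Field F] (c : F) {m : ℕ}
    {h : (Fin m → ZMod n) → F} (hh : IsAlt n F m h) :
    IsAlt n F m (fun v => c * h (-v)) := by
  refine ⟨fun π v => ?_, fun v hv => ?_⟩
  · have := hh.1 π (-v)
    simp only
    rw [show -(v ∘ π) = (-v) ∘ π from rfl, this, mul_smul_comm]
  · simp only
    rw [hh.2 (-v), mul_zero]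
    exact fun h => hv fun a b hab => h (by simp [hab])

/-- Every alternating function is the Fourier transform of an alternating function. -/
lemma IsAlt.exists_fourierT_eq {n : ℕ} [NeZero n] {F : Type*} [Field F] {ω : F}
    (hω : IsPrimitiveRoot ω n) (hn : (n : F) ≠ 0) {m : ℕ} {h : (Fin m → ZMod n) → F}
    (hh : IsAlt n F m h) : ∃ ψ, IsAlt n F m ψ ∧ fourierT n F ω m ψ = h := by
  refine ⟨fourierT n F ω m (fun v => ((n : F) ^ m)⁻¹ * h (-v)),
    (hh.smul_comp_neg _).transform ω, ?_⟩
  ext u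
  rw [fourierT_fourierT n F hω, neg_neg, mul_inv_cancel_left₀ (pow_ne_zero _ hn)]

lemma delCoord_eq_comp_succAbove (n : ℕ) {m : ℕ} (i : Fin (m + 1)) (v : Fin (m + 1) → ZMod n) :
    delCoord n i v = v ∘ i.succAbove := by
  ext j
  simp only [delCoord, Function.comp_apply, Fin.succAbove, Fin.lt_def, Fin.val_castSucc]
  split_ifs <;> rfl

lemma exists_perm_comp_succAbove {m : ℕ} (σ : Equiv.Perm (Fin (m + 1))) (i : Fin (m + 1)) :
    ∃ τ : Equiv.Perm (Fin m), (σ ∘ i.succAbove = (σ i).succAbove ∘ τ) ∧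
      (-1 : ℤ) ^ (i : ℕ) * (Equiv.Perm.sign τ : ℤ) =
        (Equiv.Perm.sign σ : ℤ) * (-1) ^ (σ i : ℕ) := by
  obtain ⟨⟨p, τ⟩, hτ⟩ := (Equiv.Perm.decomposeFin (n := m)).symm.surjective
    ((σ i).cycleRange * σ * i.cycleRange⁻¹)
  have hp : p = 0 := by
    have := congrArg (fun e : Equiv.Perm (Fin (m + 1)) => e 0) hτ
    simpa [Equiv.Perm.inv_def] using this
  subst hp
  refine ⟨τ, ?_, ?_⟩
  · ext j
    have := congrArg (fun e : Equiv.Perm (Fin (m + 1)) => (σ i).cycleRange.symm (e j.succ)) hτ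
    simp [Equiv.Perm.inv_def] at this
    simp [this]
  · have := congrArg (fun e : Equiv.Perm (Fin (m + 1)) => (Equiv.Perm.sign e : ℤ)) hτ
    simp [Fin.sign_cycleRange] at this
    rw [this]
    have h1 : ((-1 : ℤ) ^ (i : ℕ)) * (-1) ^ (i : ℕ) = 1 := by
      rw [← mul_pow]; simp
    linear_combination ((-1 : ℤ) ^ (σ i : ℕ) * (Equiv.Perm.sign σ : ℤ)) * h1

lemma IsAlt.neg_one_pow_mul_comp_perm {n : ℕ} [NeZero n] {F : Type*} [Field F] {m : ℕ}
    {ψ : (Fin m → ZMod n) → F} (hψ : IsAlt n F m ψ) (σ : Equiv.Perm (Fin (m + 1)))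
    (v : Fin (m + 1) → ZMod n) (i : Fin (m + 1)) :
    (-1 : F) ^ (i : ℕ) * ψ ((v ∘ σ) ∘ i.succAbove) =
      (Equiv.Perm.sign σ : ℤ) • ((-1 : F) ^ (σ i : ℕ) * ψ (v ∘ (σ i).succAbove)) := by
  obtain ⟨τ, h₁, h₂⟩ := exists_perm_comp_succAbove σ i
  rw [Function.comp_assoc, h₁, ← Function.comp_assoc, hψ.1 τ, zsmul_eq_mul, zsmul_eq_mul]
  have := congrArg (Int.cast : ℤ → F) h₂
  push_cast at this
  linear_combination (ψ (v ∘ (σ i).succAbove)) * this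

lemma IsAlt.coboundary {n : ℕ} [NeZero n] {F : Type*} [Field F] {m : ℕ}
    {ψ : (Fin m → ZMod n) → F} (hψ : IsAlt n F m ψ) :
    IsAlt n F (m + 1)
      (fun v => ∑ i : Fin (m + 1), (-1 : F) ^ (i : ℕ) * ψ (v ∘ i.succAbove)) := by
  refine ⟨fun π v => ?_, fun v hv => ?_⟩
  · simp_rw [hψ.neg_one_pow_mul_comp_perm π v]
    rw [← Finset.smul_sum]
    congr 1
    exact Equiv.sum_comp π (fun i => (-1 : F) ^ (i : ℕ) * ψ (v ∘ i.succAbove))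
  · obtain ⟨a, b, hab, hne⟩ := Function.not_injective_iff.mp hv
    have hvs : v ∘ Equiv.swap a b = v := by
      ext j
      simp only [Function.comp_apply, Equiv.swap_apply_def]
      split_ifs with h₁ h₂ <;> simp_all
    refine Finset.sum_involution (fun i _ => Equiv.swap a b i) ?_ ?_ ?_ ?_
    · intro i _
      have := hψ.neg_one_pow_mul_comp_perm (Equiv.swap a b) v i
      rw [hvs, Equiv.Perm.sign_swap hne] at this
      rw [this]
      simp
    · intro i _ hi hfix
      refine hi ?_
      rw [hψ.2, mul_zero]
      intro hinj
      have hia : a ≠ i := by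
        rintro rfl
        exact hne (by simpa using hfix.symm)
      have hib : b ≠ i := by
        rintro rfl
        exact hne (by simpa using hfix)
      obtain ⟨a', rfl⟩ := Fin.exists_succAbove_eq hia
      obtain ⟨b', rfl⟩ := Fin.exists_succAbove_eq hib
      exact hne (congrArg _ (hinj (show (v ∘ i.succAbove) a' = (v ∘ i.succAbove) b' from hab)))
    · simp
    · simp

lemma fourierT_comp_succAbove (n : ℕ) [NeZero n] (F : Type*) [Field F] {ω : F}
    (hω : IsPrimitiveRoot ω n) {m : ℕ} (ψ : (Fin m → ZMod n) → F) (i : Fin (m + 1))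
    (u : Fin (m + 1) → ZMod n) :
    fourierT n F ω (m + 1) (fun v => ψ (v ∘ i.succAbove)) u =
      if u i = 0 then (n : F) * fourierT n F ω m ψ (u ∘ i.succAbove) else 0 := by
  unfold fourierT
  rw [← Equiv.sum_comp (Fin.insertNthEquiv (fun _ => ZMod n) i), Fintype.sum_prod_type]
  have h : ∀ (a : ZMod n) (y : Fin m → ZMod n),
      ψ ((Fin.insertNthEquiv (fun _ => ZMod n) i (a, y)) ∘ i.succAbove) *
        eF n F ω (-(∑ j, u j * (Fin.insertNthEquiv (fun _ => ZMod n) i (a, y)) j)) =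
      eF n F ω (a * -u i) * (ψ y * eF n F ω (-(∑ j, (u ∘ i.succAbove) j * y j))) := by
    intro a y
    have h₁ : (Fin.insertNthEquiv (fun _ => ZMod n) i (a, y)) ∘ i.succAbove = y := by
      ext j; simp
    rw [h₁, Fin.sum_univ_succAbove _ i, neg_add, eF_add n F hω]
    simp only [Fin.insertNthEquiv_apply, Fin.insertNth_apply_same,
      Fin.insertNth_apply_succAbove, Function.comp_apply]
    rw [show -(u i * a) = a * -u i by ring]
    ring
  simp_rw [h, ← Finset.mul_sum, ← Finset.sum_mul, sum_eF_mul n F hω, neg_eq_zero, ite_mul,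
    zero_mul]

lemma fourierT_coboundary (n : ℕ) [NeZero n] (F : Type*) [Field F] {ω : F}
    (hω : IsPrimitiveRoot ω n) {m : ℕ} (ψ : (Fin m → ZMod n) → F) (u : Fin (m + 1) → ZMod n) :
    fourierT n F ω (m + 1)
        (fun v => ∑ i : Fin (m + 1), (-1 : F) ^ (i : ℕ) * ψ (v ∘ i.succAbove)) u =
      ∑ i : Fin (m + 1), (-1 : F) ^ (i : ℕ) *
        if u i = 0 then (n : F) * fourierT n F ω m ψ (u ∘ i.succAbove) else 0 := by
  simp_rw [← fourierT_comp_succAbove n F hω]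
  unfold fourierT
  simp_rw [Finset.sum_mul, Finset.mul_sum, mul_assoc]
  exact Finset.sum_comm

lemma IsAlt.apply_cons_succAbove {n : ℕ} [NeZero n] {F : Type*} [Field F] {m : ℕ}
    {g : (Fin (m + 1) → ZMod n) → F} (hg : IsAlt n F (m + 1) g) (u : Fin (m + 1) → ZMod n)
    (i : Fin (m + 1)) :
    g (Fin.cons (u i) (u ∘ i.succAbove)) = (-1 : F) ^ (i : ℕ) * g u := by
  have h : (Fin.cons (u i) (u ∘ i.succAbove) : Fin (m + 1) → ZMod n) =
      u ∘ (i.cycleRange⁻¹ : Equiv.Perm (Fin (m + 1))) := by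
    ext j
    refine Fin.cases ?_ (fun j => ?_) j <;> simp [Equiv.Perm.inv_def]
  rw [h, hg.1]
  simp [Fin.sign_cycleRange]

lemma IsAlt.cons {n : ℕ} [NeZero n] {F : Type*} [Field F] {m : ℕ}
    {g : (Fin (m + 1) → ZMod n) → F} (hg : IsAlt n F (m + 1) g) (a : ZMod n) (c : F) :
    IsAlt n F m (fun w => c * g (Fin.cons a w)) := by
  refine ⟨fun π v => ?_, fun v hv => ?_⟩
  · have h : (Fin.cons a (v ∘ π) : Fin (m + 1) → ZMod n) =
        Fin.cons a v ∘ (Equiv.Perm.decomposeFin.symm (0, π)) := by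
      ext j
      refine Fin.cases ?_ (fun j => ?_) j <;> simp
    simp only
    rw [h, hg.1, mul_smul_comm]
    simp
  · simp only
    rw [hg.2, mul_zero]
    exact fun h => hv (Fin.cons_injective_iff.mp h).2

/-- The alternating functions vanishing on the tuples without a zero coordinate. -/
def altZeroSubmodule (n : ℕ) [NeZero n] (F : Type*) [Field F] (k : ℕ) :
    Submodule F ((Fin k → ZMod n) → F) where
  carrier := {g | IsAlt n F k g ∧ ∀ u : Fin k → ZMod n, (∀ i, u i ≠ 0) → g u = 0}
  zero_mem' := by simp [IsAlt]
  add_mem' := by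
    rintro f g ⟨⟨hf₁, hf₂⟩, hf₃⟩ ⟨⟨hg₁, hg₂⟩, hg₃⟩
    refine ⟨⟨fun π v => ?_, fun v hv => ?_⟩, fun u hu => ?_⟩
    · simp [hf₁, hg₁]
    · simp [hf₂ v hv, hg₂ v hv]
    · simp [hf₃ u hu, hg₃ u hu]
  smul_mem' := by
    rintro c f ⟨⟨hf₁, hf₂⟩, hf₃⟩
    refine ⟨⟨fun π v => ?_, fun v hv => ?_⟩, fun u hu => ?_⟩
    · simp only [Pi.smul_apply]
      rw [hf₁, smul_comm]
    · simp [hf₂ v hv]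
    · simp [hf₃ u hu]

/-- The tuple listing `0` followed by the elements of the `m`-element set `T`. -/
noncomputable def zeroTuple (n : ℕ) [NeZero n] (m : ℕ)
    (T : Finset.powersetCard m ((Finset.univ : Finset (ZMod n)).erase 0)) :
    Fin (m + 1) → ZMod n :=
  Fin.cons 0 fun j => (T.1.equivFinOfCardEq (Finset.mem_powersetCard.mp T.2).2).symm j

lemma mem_range_zeroTuple {n : ℕ} [NeZero n] {m : ℕ}
    {T : Finset.powersetCard m ((Finset.univ : Finset (ZMod n)).erase 0)} {x : ZMod n} :
    x ∈ Set.range (zeroTuple n m T) ↔ x = 0 ∨ x ∈ T.1 := by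
  rw [zeroTuple, Fin.range_cons, Set.mem_insert_iff]
  refine or_congr Iff.rfl ⟨?_, fun hx => ?_⟩
  · rintro ⟨j, rfl⟩
    exact Subtype.coe_prop _
  · exact ⟨T.1.equivFinOfCardEq (Finset.mem_powersetCard.mp T.2).2 ⟨x, hx⟩, by simp⟩

lemma zero_notMem_of_mem_powersetCard {n : ℕ} [NeZero n] {m : ℕ}
    (T : Finset.powersetCard m ((Finset.univ : Finset (ZMod n)).erase 0)) : (0 : ZMod n) ∉ T.1 :=
  fun h => by simpa using (Finset.mem_powersetCard.mp T.2).1 h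

lemma zeroTuple_injective {n : ℕ} [NeZero n] {m : ℕ}
    (T : Finset.powersetCard m ((Finset.univ : Finset (ZMod n)).erase 0)) :
    Function.Injective (zeroTuple n m T) := by
  refine Fin.cons_injective_iff.mpr ⟨?_, fun a b hab => ?_⟩
  · rintro ⟨j, hj⟩
    exact ne_of_mem_of_not_mem (Subtype.coe_prop _) (zero_notMem_of_mem_powersetCard T) hj
  · simpa using hab

lemma exists_eq_zeroTuple_comp {n : ℕ} [NeZero n] {m : ℕ} {v : Fin (m + 1) → ZMod n}
    (hv : Function.Injective v) {i : Fin (m + 1)} (hi : v i = 0) :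
    ∃ T, ∃ π : Equiv.Perm (Fin (m + 1)), v = zeroTuple n m T ∘ π := by
  classical
  have hT : (Finset.univ.image v).erase 0 ∈
      Finset.powersetCard m ((Finset.univ : Finset (ZMod n)).erase 0) := by
    rw [Finset.mem_powersetCard]
    refine ⟨Finset.erase_subset_erase _ (Finset.subset_univ _), ?_⟩
    rw [Finset.card_erase_of_mem (Finset.mem_image.mpr ⟨i, Finset.mem_univ _, hi⟩),
      Finset.card_image_of_injective _ hv]
    simp
  have hr : ∀ j, ∃ l, zeroTuple n m ⟨_, hT⟩ l = v j := fun j => by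
    refine mem_range_zeroTuple.mpr ?_
    by_cases h : v j = 0 <;> simp [h]
  choose p hp using hr
  have hpi : Function.Injective p := fun a b hab => hv (by rw [← hp a, ← hp b, hab])
  refine ⟨⟨_, hT⟩, Equiv.ofBijective p (Finite.injective_iff_bijective.mp hpi), ?_⟩
  ext j
  simp [hp]

/-- Evaluation on the tuples `zeroTuple` identifies `altZeroSubmodule` with a coordinate space. -/
noncomputable def evalZeroTuple (n : ℕ) [NeZero n] (F : Type*) [Field F] (m : ℕ) :
    altZeroSubmodule n F (m + 1) →ₗ[F]
      (Finset.powersetCard m ((Finset.univ : Finset (ZMod n)).erase 0) → F) where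
  toFun g T := g.1 (zeroTuple n m T)
  map_add' _ _ := rfl
  map_smul' _ _ := rfl

lemma evalZeroTuple_injective (n : ℕ) [NeZero n] (F : Type*) [Field F] (m : ℕ) :
    Function.Injective (evalZeroTuple n F m) := by
  refine (injective_iff_map_eq_zero _).mpr fun g hg => Subtype.ext (funext fun v => ?_)
  by_cases hv : Function.Injective v
  · by_cases h0 : ∀ i, v i ≠ 0
    · exact g.2.2 v h0
    · push Not at h0
      obtain ⟨i, hi⟩ := h0
      obtain ⟨T, π, rfl⟩ := exists_eq_zeroTuple_comp hv hi
      rw [g.2.1.1 π, show g.1 (zeroTuple n m T) = 0 from congrFun hg T]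
      simp
  · exact g.2.1.2 v hv

lemma evalZeroTuple_surjective (n : ℕ) [NeZero n] (F : Type*) [Field F] (m : ℕ) :
    Function.Surjective (evalZeroTuple n F m) := by
  classical
  intro f
  let M (T : Finset.powersetCard m ((Finset.univ : Finset (ZMod n)).erase 0))
    (v : Fin (m + 1) → ZMod n) : Matrix (Fin (m + 1)) (Fin (m + 1)) F :=
    Matrix.of fun i j => if v i = zeroTuple n m T j then 1 else 0
  refine ⟨⟨fun v => ∑ T, f T * (M T v).det, ⟨fun π v => ?_, fun v hv => ?_⟩, fun v hv => ?_⟩, ?_⟩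
  · simp only
    rw [Finset.smul_sum]
    refine Finset.sum_congr rfl fun T _ => ?_
    rw [show M T (v ∘ π) = (M T v).submatrix π id from rfl, Matrix.det_permute]
    simp only [zsmul_eq_mul]
    ring
  · obtain ⟨a, b, hab, hne⟩ := Function.not_injective_iff.mp hv
    refine Finset.sum_eq_zero fun T _ => ?_
    rw [Matrix.det_zero_of_row_eq hne, mul_zero]
    ext j
    simp [M, hab]
  · refine Finset.sum_eq_zero fun T _ => ?_
    rw [Matrix.det_eq_zero_of_column_eq_zero 0, mul_zero]
    intro i
    simp [M, zeroTuple, hv i]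
  · ext S
    change ∑ T, f T * (M T (zeroTuple n m S)).det = f S
    rw [Finset.sum_eq_single S]
    · have : M S (zeroTuple n m S) = 1 := by
        ext i j
        simp [M, Matrix.one_apply, (zeroTuple_injective S).eq_iff]
      simp [this]
    · intro T _ hTS
      have hsub : ¬ S.1 ⊆ T.1 := fun h => hTS <| Subtype.ext <| Eq.symm <|
        Finset.eq_of_subset_of_card_le h (by
          rw [(Finset.mem_powersetCard.mp S.2).2, (Finset.mem_powersetCard.mp T.2).2])
      obtain ⟨x, hxS, hxT⟩ := Finset.not_subset.mp hsub
      obtain ⟨i, hi⟩ := mem_range_zeroTuple.mpr (Or.inr hxS)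
      rw [Matrix.det_eq_zero_of_row_eq_zero i, mul_zero]
      intro j
      refine if_neg fun h => ?_
      rcases mem_range_zeroTuple.mp ⟨j, (hi.symm.trans h).symm⟩ with rfl | h'
      · exact zero_notMem_of_mem_powersetCard S hxS
      · exact hxT h'
    · simp

lemma finrank_altZeroSubmodule (n : ℕ) [NeZero n] (F : Type*) [Field F] (m : ℕ) :
    Module.finrank F (altZeroSubmodule n F (m + 1)) = (n - 1).choose m := by
  rw [(LinearEquiv.ofBijective (evalZeroTuple n F m)
    ⟨evalZeroTuple_injective n F m, evalZeroTuple_surjective n F m⟩).finrank_eq]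
  rw [Module.finrank_fintype_fun_eq_card, Fintype.card_coe, Finset.card_powersetCard,
    Finset.card_erase_of_mem (Finset.mem_univ _), Finset.card_univ, ZMod.card]

lemma set_finrank_altZeroSubmodule (n : ℕ) [NeZero n] (F : Type*) [Field F] (m : ℕ) :
    Set.finrank F (altZeroSubmodule n F (m + 1) : Set ((Fin (m + 1) → ZMod n) → F)) =
      (n - 1).choose m := by
  rw [Set.finrank, Submodule.span_eq, finrank_altZeroSubmodule]

/-- The Fourier transform as a linear map. -/
noncomputable def fourierLinear (n : ℕ) [NeZero n] (F : Type*) [Field F] (ω : F) (k : ℕ) :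
    ((Fin k → ZMod n) → F) →ₗ[F] ((Fin k → ZMod n) → F) where
  toFun := fourierT n F ω k
  map_add' f g := by
    ext u
    simp [fourierT, add_mul, Finset.sum_add_distrib]
  map_smul' c f := by
    ext u
    simp [fourierT, mul_assoc, Finset.mul_sum]

lemma fourierLinear_injective (n : ℕ) [NeZero n] (F : Type*) [Field F] {ω : F}
    (hω : IsPrimitiveRoot ω n) (hn : (n : F) ≠ 0) (k : ℕ) :
    Function.Injective (fourierLinear n F ω k) := by
  refine (injective_iff_map_eq_zero _).mpr fun f hf => funext fun u => ?_
  have h := fourierT_fourierT n F hω f (-u)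
  rw [show fourierT n F ω k f = 0 from hf, neg_neg] at h
  have h0 : fourierT n F ω k 0 (-u) = 0 := by simp [fourierT]
  rw [h0] at h
  exact (mul_eq_zero.mp h.symm).resolve_left (pow_ne_zero _ hn)

lemma fourierT_image_coboundary (n : ℕ) [NeZero n] (F : Type*) [Field F] {ω : F}
    (hω : IsPrimitiveRoot ω n) (hn : (n : F) ≠ 0) (m : ℕ) :
    fourierT n F ω (m + 1) ''
        {φ | ∃ ψ : (Fin m → ZMod n) → F, IsAlt n F m ψ ∧
          φ = fun v => ∑ i : Fin (m + 1), (-1 : F) ^ (i : ℕ) * ψ (v ∘ i.succAbove)} =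
      altZeroSubmodule n F (m + 1) := by
  ext g
  constructor
  · rintro ⟨_, ⟨ψ, hψ, rfl⟩, rfl⟩
    refine ⟨hψ.coboundary.transform ω, fun u hu => ?_⟩
    rw [fourierT_coboundary n F hω]
    simp [hu]
  · rintro ⟨hg, hg0⟩
    obtain ⟨ψ, hψ, hψg⟩ := (hg.cons 0 (n : F)⁻¹).exists_fourierT_eq hω hn
    refine ⟨_, ⟨ψ, hψ, rfl⟩, funext fun u => ?_⟩
    by_cases hu : Function.Injective u
    · rw [fourierT_coboundary n F hω, hψg]
      by_cases h0 : ∀ i, u i ≠ 0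
      · simp [h0, hg0 u h0]
      · push Not at h0
        obtain ⟨i, hi⟩ := h0
        rw [Finset.sum_eq_single i]
        · have h := hg.apply_cons_succAbove u i
          rw [hi] at h
          simp only [if_pos hi]
          rw [h, mul_inv_cancel_left₀ hn, ← mul_assoc, ← mul_pow]
          simp
        · intro j _ hj
          rw [if_neg, mul_zero]
          exact fun h => hj (hu (h.trans hi.symm))
        · simp
    · rw [hg.2 u hu]
      exact (hψ.coboundary.transform ω).2 u hu

/-- the Fourier image of the coboundary space `B^{k-1}(X_A;F)` is exactly
the space of alternating functions `g : ℤ_n^k → F` vanishing on all tuples all of whose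
coordinates are nonzero; both spaces have dimension `C(n-1, k-1)`. -/
theorem fourier_image_of_coboundaries (n k : ℕ) [NeZero n] (hk : 0 < k)
    (hcop : Nat.Coprime (k + 1) n) (A : Finset (ZMod n)) (hA : A.card = k + 1)
    (F : Type*) [Field F] (hchar : ¬ (ringChar F ∣ n)) (ω : F)
    (hω : IsPrimitiveRoot ω n) :
    fourierT n F ω k ''
        {φ | ∃ ψ : (Fin (k - 1) → ZMod n) → F, IsAlt n F (k - 1) ψ ∧
          φ = fun v => ∑ i : Fin k, (-1 : F) ^ (i : ℕ) * ψ (delCoord n i v)}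
      = {g | IsAlt n F k g ∧ ∀ u : Fin k → ZMod n, (∀ i, u i ≠ 0) → g u = 0} ∧
    Set.finrank F
        {φ | ∃ ψ : (Fin (k - 1) → ZMod n) → F, IsAlt n F (k - 1) ψ ∧
          φ = fun v => ∑ i : Fin k, (-1 : F) ^ (i : ℕ) * ψ (delCoord n i v)}
      = Nat.choose (n - 1) (k - 1) ∧
    Set.finrank F
        {g : (Fin k → ZMod n) → F |
          IsAlt n F k g ∧ ∀ u : Fin k → ZMod n, (∀ i, u i ≠ 0) → g u = 0}
      = Nat.choose (n - 1) (k - 1) := by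
  obtain ⟨m, rfl⟩ : ∃ m, k = m + 1 := ⟨k - 1, by omega⟩
  have hn : (n : F) ≠ 0 := fun h => hchar ((ringChar.spec F n).mp h)
  have himage := fourierT_image_coboundary n F hω hn m
  simp_rw [← delCoord_eq_comp_succAbove] at himage
  refine ⟨himage, ?_, ?_⟩
  · let L := LinearEquiv.ofInjectiveEndo _ (fourierLinear_injective n F hω hn (m + 1))
    have hL : L '' {φ | ∃ ψ : (Fin m → ZMod n) → F, IsAlt n F m ψ ∧
        φ = fun v => ∑ i : Fin (m + 1), (-1 : F) ^ (i : ℕ) * ψ (delCoord n i v)} =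
        altZeroSubmodule n F (m + 1) := himage
    have h := L.finrank_map_eq (Submodule.span F {φ | ∃ ψ : (Fin m → ZMod n) → F,
      IsAlt n F m ψ ∧
        φ = fun v => ∑ i : Fin (m + 1), (-1 : F) ^ (i : ℕ) * ψ (delCoord n i v)})
    rw [Submodule.map_span, LinearEquiv.coe_coe, hL] at h
    exact h.symm.trans (set_finrank_altZeroSubmodule n F m)
  · exact set_finrank_altZeroSubmodule n F m
end

section
/- Let n, k be positive integers, let σ be a permutation of {1,…,k} acting on ℤ_n^k by permuting coordinates, and let 1 ≤ i ≤ k. Then the composite T^i ∘ σ ∘ T^{−σ^{-1}(i)} (a permutation of ℤ_n^k, where T^{−j} denotes T^{k+1−j}) equals the coordinate-permutation action of a permutation η of {1,…,k}, and sgn(η) = (−1)^{k(i + σ^{-1}(i))} · sgn(σ). -/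
open scoped BigOperators

/-- The automorphism `T` of `ℤ_n^k`:
`T(u_1,…,u_k) = (u_2 - u_1, …, u_k - u_1, -u_1)` (0-indexed). -/
def Ttrans (n k : ℕ) (u : Fin k → ZMod n) : Fin k → ZMod n :=
  fun i =>
    (if h : (i : ℕ) + 1 < k then u ⟨(i : ℕ) + 1, h⟩ else 0) -
      u ⟨0, Nat.lt_of_le_of_lt (Nat.zero_le _) i.isLt⟩

open Equiv

theorem val_finRotate_pow_apply (k m : ℕ) (x : Fin (k + 1)) :
    ((finRotate (k + 1) ^ m) x : ℕ) = (x + m) % (k + 1) := by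
  induction m with
  | zero => simp [Nat.mod_eq_of_lt x.isLt]
  | succ m ih =>
    rw [pow_succ', Perm.mul_apply, finRotate_apply, Fin.val_add, ih, Fin.val_one',
      ← Nat.add_mod, add_assoc]

theorem finRotate_pow_eq_zero {k : ℕ} (m : ℕ) (x : Fin (k + 1)) (h : (x : ℕ) + m = k + 1) :
    (finRotate (k + 1) ^ m) x = 0 := by
  ext
  rw [val_finRotate_pow_apply, h, Nat.mod_self, Fin.val_zero]

/-- Adjoining a zeroth coordinate equal to `0` turns `T` into a rotation of the coordinates,
up to a translation. -/
theorem cons_Ttrans (n k : ℕ) (u : Fin k → ZMod n) (j : Fin (k + 1)) :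
    (Fin.cons 0 (Ttrans n k u) : Fin (k + 1) → ZMod n) j =
      (Fin.cons 0 u : Fin (k + 1) → ZMod n) (finRotate (k + 1) j) -
        (Fin.cons 0 u : Fin (k + 1) → ZMod n) (finRotate (k + 1) 0) := by
  refine Fin.cases ?_ (fun l => ?_) j
  · simp
  have hk : 0 < k := l.pos
  have h0 : finRotate (k + 1) 0 = Fin.succ ⟨0, hk⟩ := by
    ext
    rw [coe_finRotate_of_ne_last (by simp [Fin.ext_iff]; omega)]
    simp
  rw [h0, Fin.cons_succ, Fin.cons_succ, Ttrans]
  congr 1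
  split_ifs with h
  · have : finRotate (k + 1) l.succ = Fin.succ ⟨l + 1, h⟩ := by
      ext
      rw [coe_finRotate_of_ne_last (by simp [Fin.ext_iff]; omega)]
      simp
    rw [this, Fin.cons_succ]
  · have : l.succ = Fin.last k := by ext; simp; omega
    rw [this, finRotate_last, Fin.cons_zero]

theorem cons_Ttrans_iterate (n k m : ℕ) (u : Fin k → ZMod n) (j : Fin (k + 1)) :
    (Fin.cons 0 ((Ttrans n k)^[m] u) : Fin (k + 1) → ZMod n) j =
      (Fin.cons 0 u : Fin (k + 1) → ZMod n) ((finRotate (k + 1) ^ m) j) -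
        (Fin.cons 0 u : Fin (k + 1) → ZMod n) ((finRotate (k + 1) ^ m) 0) := by
  induction m generalizing j with
  | zero => simp
  | succ m ih =>
    rw [Function.iterate_succ_apply', cons_Ttrans, ih, ih, pow_succ, Perm.mul_apply,
      Perm.mul_apply, sub_sub_sub_cancel_right]

theorem cons_comp_perm {M : Type*} {k : ℕ} (c : M) (u : Fin k → M) (σ : Perm (Fin k))
    (j : Fin (k + 1)) :
    (Fin.cons c (u ∘ σ) : Fin (k + 1) → M) j =
      (Fin.cons c u : Fin (k + 1) → M) (Perm.decomposeFin.symm (0, σ) j) := by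
  refine Fin.cases ?_ (fun l => ?_) j <;> simp

theorem exists_decomposeFin_symm_eq {k : ℕ} (τ : Perm (Fin (k + 1))) (h : τ 0 = 0) :
    ∃ η : Perm (Fin k), Perm.decomposeFin.symm (0, η) = τ := by
  obtain ⟨⟨p, η⟩, rfl⟩ := Perm.decomposeFin.symm.surjective τ
  rw [Perm.decomposeFin_symm_apply_zero] at h
  exact ⟨η, by rw [h]⟩

/-- for a permutation `σ` of the coordinates (acting by
`(σ·u)_j = u_{σ⁻¹(j)}`) and `1 ≤ i ≤ k` (here written 0-indexed, so the paper's `i` is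
`(i:ℕ)+1` and `σ⁻¹(i)` is `(σ⁻¹ i : ℕ)+1`), the composite `T^i ∘ σ ∘ T^{-σ⁻¹(i)}`
(with `T^{-j} = T^{k+1-j}`) is the coordinate-permutation action of some `η ∈ S_k` with
`sgn(η) = (-1)^{k(i + σ⁻¹(i))} sgn(σ)`. -/
theorem T_perm_conjugation (n k : ℕ) [NeZero n] (hk : 0 < k)
    (σ : Equiv.Perm (Fin k)) (i : Fin k) :
    ∃ η : Equiv.Perm (Fin k),
      (∀ u : Fin k → ZMod n,
        (Ttrans n k)^[(i : ℕ) + 1]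
            (((Ttrans n k)^[k - ((σ⁻¹ i : Fin k) : ℕ)] u) ∘ ⇑σ⁻¹)
          = u ∘ ⇑η⁻¹) ∧
      Equiv.Perm.sign η =
        (-1 : ℤˣ) ^ (k * ((((i : ℕ)) + 1) + (((σ⁻¹ i : Fin k) : ℕ) + 1))) *
          Equiv.Perm.sign σ := by
  set a : Fin k := σ⁻¹ i with ha
  set R := finRotate (k + 1) with hR
  obtain ⟨ρ, hρ⟩ := exists_decomposeFin_symm_eq
    (R ^ (k - (a : ℕ)) * Perm.decomposeFin.symm (0, σ⁻¹) * R ^ ((i : ℕ) + 1)) (by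
      have h0 : (R ^ ((i : ℕ) + 1)) 0 = i.succ := by
        ext
        rw [val_finRotate_pow_apply, Fin.val_zero, zero_add, Fin.val_succ,
          Nat.mod_eq_of_lt (by omega)]
      rw [Perm.mul_apply, h0, Perm.mul_apply, Perm.decomposeFin_symm_apply_succ, ← ha,
        swap_self, refl_apply]
      exact finRotate_pow_eq_zero _ _ (by rw [Fin.val_succ]; omega))
  have hρ' (j : Fin (k + 1)) : (R ^ (k - (a : ℕ))) (Perm.decomposeFin.symm (0, σ⁻¹)
      ((R ^ ((i : ℕ) + 1)) j)) = Perm.decomposeFin.symm (0, ρ) j := by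
    rw [hρ]; rfl
  refine ⟨ρ⁻¹, fun u => ?_, ?_⟩
  · ext j
    have h := cons_Ttrans_iterate n k ((i : ℕ) + 1)
      (((Ttrans n k)^[k - (a : ℕ)] u) ∘ ⇑σ⁻¹) j.succ
    rw [Fin.cons_succ, cons_comp_perm, cons_comp_perm, cons_Ttrans_iterate,
      cons_Ttrans_iterate, ← hR,
      sub_sub_sub_cancel_right, hρ', hρ', Perm.decomposeFin_symm_apply_zero,
      Perm.decomposeFin_symm_apply_succ] at h
    simpa using h
  · have hs := congrArg Perm.sign hρ
    rw [Perm.decomposeFin.symm_sign, if_pos rfl, one_mul, map_mul, map_mul, map_pow, map_pow,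
      hR, sign_finRotate, Perm.decomposeFin.symm_sign, if_pos rfl, one_mul, Perm.sign_inv,
      ← pow_mul, ← pow_mul, Nat.succ_eq_add_one, Nat.add_sub_cancel] at hs
    have hpar : (-1 : ℤˣ) ^ (k * (k - (a : ℕ))) = (-1) ^ (k * ((a : ℕ) + 1)) := by
      have hsum : k * (k - (a : ℕ)) + k * ((a : ℕ) + 1) = k * (k + 1) := by
        rw [← mul_add]; congr 1; omega
      have hmul : (-1 : ℤˣ) ^ (k * (k - (a : ℕ))) * (-1) ^ (k * ((a : ℕ) + 1)) = 1 := by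
        rw [← pow_add, hsum, (Nat.even_mul_succ_self k).neg_one_pow]
      rw [eq_inv_of_mul_eq_one_left hmul, Int.units_inv_eq_self]
    rw [Perm.sign_inv, hs, hpar, mul_add k ((i : ℕ) + 1), pow_add _ (k * ((i : ℕ) + 1))]
    ac_rfl
end
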